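/- arXiv:2506.07264 — 6 statements merged into one kernel-verified Lean document; each statement's English description precedes it below -/
import Mathlib

section
/- Let G be a simple graph of order n with diameter exactly 2. If G is not isomorphic to the star K_{1,n-1} and not isomorphic to the cycle C_5, then s⁺(G) ≥ n. -/
open Matrix

namespace SquareEnergy

theorem adj_isHermitian {V : Type*} [Fintype V] [DecidableEq V] (G : SimpleGraph V)
    [DecidableRel G.Adj] : (G.adjMatrix ℝ).IsHermitian :=
  ((G.adjMatrix ℝ).conjTranspose_eq_transpose_of_trivial).trans (SimpleGraph.isSymm_adjMatrix G)

/-- The eigenvalues of the adjacency matrix of `G`, as a function `V → ℝ`. -/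
noncomputable def adjEig {V : Type*} [Fintype V] [DecidableEq V] (G : SimpleGraph V) : V → ℝ :=
  letI := Classical.decRel G.Adj
  (adj_isHermitian G).eigenvalues

/-- Positive square energy `s⁺(G)`. -/
noncomputable def sPlus {V : Type*} [Fintype V] [DecidableEq V] (G : SimpleGraph V) : ℝ :=
  ∑ i, if 0 < adjEig G i then (adjEig G i) ^ 2 else 0

section

theorem quad_le {V : Type*} [Fintype V] [DecidableEq V] {A : Matrix V V ℝ}
    (hA : A.IsHermitian) (x y : V → ℝ) {α β : ℝ} (hα : 0 ≤ α) (hβ : 0 ≤ β) :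
    2 * (α * (x ⬝ᵥ A *ᵥ x) + β * (y ⬝ᵥ A *ᵥ y)) -
      (α ^ 2 * (x ⬝ᵥ x) ^ 2 + 2 * (α * β) * (x ⬝ᵥ y) ^ 2 + β ^ 2 * (y ⬝ᵥ y) ^ 2) ≤
      ∑ i, if 0 < hA.eigenvalues i then hA.eigenvalues i ^ 2 else 0 := by
  set b := hA.eigenvectorBasis
  set c : (V → ℝ) → V → ℝ := fun z i => (b i : V → ℝ) ⬝ᵥ z with hc
  have parseval (z w : V → ℝ) : z ⬝ᵥ w = ∑ i, c z i * c w i := by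
    have h := b.sum_inner_mul_inner (WithLp.toLp 2 z) (WithLp.toLp 2 w)
    simp only [EuclideanSpace.inner_eq_star_dotProduct, star_trivial] at h
    rw [dotProduct_comm, ← h]
    refine Finset.sum_congr rfl fun i _ => ?_
    simp only [hc]
    rw [dotProduct_comm w]
  have coeff (z : V → ℝ) (i : V) : c (A *ᵥ z) i = hA.eigenvalues i * c z i := by
    have h := hA.mulVec_eigenvectorBasis i
    have hT : Aᵀ = A := (conjTranspose_eq_transpose_of_trivial A).symm.trans hA
    simp only [hc]
    rw [dotProduct_mulVec, ← mulVec_transpose, hT, h, smul_dotProduct, smul_eq_mul]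
  have quad (z : V → ℝ) : z ⬝ᵥ A *ᵥ z = ∑ i, hA.eigenvalues i * c z i ^ 2 := by
    rw [parseval]
    refine Finset.sum_congr rfl fun i _ => ?_
    rw [coeff]; ring
  have frob : ∑ i, ∑ j, (α * (c x i * c x j) + β * (c y i * c y j)) ^ 2 =
      α ^ 2 * (x ⬝ᵥ x) ^ 2 + 2 * (α * β) * (x ⬝ᵥ y) ^ 2 + β ^ 2 * (y ⬝ᵥ y) ^ 2 := by
    simp only [parseval, sq, Finset.sum_mul_sum]
    simp only [Finset.mul_sum, ← Finset.sum_add_distrib]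
    refine Finset.sum_congr rfl fun i _ => Finset.sum_congr rfl fun j _ => ?_
    ring
  have diag : ∑ i, (α * c x i ^ 2 + β * c y i ^ 2) ^ 2 ≤
      ∑ i, ∑ j, (α * (c x i * c x j) + β * (c y i * c y j)) ^ 2 := by
    refine Finset.sum_le_sum fun i _ => ?_
    refine le_trans (le_of_eq ?_)
      (Finset.single_le_sum (fun j _ => sq_nonneg _) (Finset.mem_univ i))
    ring
  rw [← frob, quad, quad]
  refine (sub_le_sub_left diag _).trans ?_
  simp only [Finset.mul_sum, ← Finset.sum_add_distrib, ← Finset.sum_sub_distrib]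
  refine Finset.sum_le_sum fun i _ => ?_
  have ht : 0 ≤ α * c x i ^ 2 + β * c y i ^ 2 := by positivity
  split_ifs with h
  · nlinarith [sq_nonneg (hA.eigenvalues i - (α * c x i ^ 2 + β * c y i ^ 2))]
  · nlinarith [mul_nonneg ht (neg_nonneg.2 (not_lt.1 h)),
      sq_nonneg (α * c x i ^ 2 + β * c y i ^ 2)]

variable {V : Type*} (G : SimpleGraph V)

theorem quad_le_sPlus [Fintype V] [DecidableEq V] [DecidableRel G.Adj]
    (x y : V → ℝ) {α β : ℝ} (hα : 0 ≤ α) (hβ : 0 ≤ β) :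
    2 * (α * (x ⬝ᵥ G.adjMatrix ℝ *ᵥ x) + β * (y ⬝ᵥ G.adjMatrix ℝ *ᵥ y)) -
      (α ^ 2 * (x ⬝ᵥ x) ^ 2 + 2 * (α * β) * (x ⬝ᵥ y) ^ 2 + β ^ 2 * (y ⬝ᵥ y) ^ 2) ≤ sPlus G := by
  convert quad_le (adj_isHermitian G) x y hα hβ using 1
  unfold sPlus adjEig
  congr!

/-- Two orthogonal vectors with Rayleigh quotients at least `s` and `t` contribute
`s ^ 2 + t ^ 2` to the positive square energy. -/
theorem sq_add_sq_le_sPlus [Fintype V] [DecidableEq V] [DecidableRel G.Adj]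
    {x y : V → ℝ} {s t : ℝ} (hs : 0 ≤ s) (ht : 0 ≤ t)
    (hx : 0 < x ⬝ᵥ x) (hy : 0 < y ⬝ᵥ y) (hxy : x ⬝ᵥ y = 0)
    (hxs : s * (x ⬝ᵥ x) ≤ x ⬝ᵥ G.adjMatrix ℝ *ᵥ x)
    (hyt : t * (y ⬝ᵥ y) ≤ y ⬝ᵥ G.adjMatrix ℝ *ᵥ y) : s ^ 2 + t ^ 2 ≤ sPlus G := by
  have key := quad_le_sPlus G x y (α := s / (x ⬝ᵥ x)) (β := t / (y ⬝ᵥ y))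
    (by positivity) (by positivity)
  have h1 : s * s ≤ s / (x ⬝ᵥ x) * (x ⬝ᵥ G.adjMatrix ℝ *ᵥ x) := by
    calc s * s = s / (x ⬝ᵥ x) * (s * (x ⬝ᵥ x)) := by field_simp
      _ ≤ _ := by gcongr
  have h2 : t * t ≤ t / (y ⬝ᵥ y) * (y ⬝ᵥ G.adjMatrix ℝ *ᵥ y) := by
    calc t * t = t / (y ⬝ᵥ y) * (t * (y ⬝ᵥ y)) := by field_simp
      _ ≤ _ := by gcongr
  have h3 : (s / (x ⬝ᵥ x)) ^ 2 * (x ⬝ᵥ x) ^ 2 = s ^ 2 := by field_simp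
  have h4 : (t / (y ⬝ᵥ y)) ^ 2 * (y ⬝ᵥ y) ^ 2 = t ^ 2 := by field_simp
  rw [h3, h4, hxy] at key
  linarith

theorem sq_le_sPlus [Fintype V] [DecidableEq V] [DecidableRel G.Adj]
    {x : V → ℝ} {s : ℝ} (hs : 0 ≤ s) (hx : 0 < x ⬝ᵥ x)
    (hxs : s * (x ⬝ᵥ x) ≤ x ⬝ᵥ G.adjMatrix ℝ *ᵥ x) : s ^ 2 ≤ sPlus G := by
  have key := quad_le_sPlus G x 0 (α := s / (x ⬝ᵥ x)) (β := 0) (by positivity) le_rfl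
  have h1 : s * s ≤ s / (x ⬝ᵥ x) * (x ⬝ᵥ G.adjMatrix ℝ *ᵥ x) := by
    calc s * s = s / (x ⬝ᵥ x) * (s * (x ⬝ᵥ x)) := by field_simp
      _ ≤ _ := by gcongr
  have h3 : (s / (x ⬝ᵥ x)) ^ 2 * (x ⬝ᵥ x) ^ 2 = s ^ 2 := by field_simp
  rw [h3] at key
  simp only [dotProduct_zero] at key
  linarith

theorem dotProduct_self_pos [Fintype V] {x : V → ℝ} {u : V} (hu : x u ≠ 0) : 0 < x ⬝ᵥ x :=
  (mul_self_pos.2 hu).trans_le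
    (Finset.single_le_sum (f := fun i => x i * x i) (fun i _ => mul_self_nonneg (x i))
      (Finset.mem_univ u))

theorem mul_dotProduct_self_le_of_forall [Fintype V] [DecidableRel G.Adj] {x : V → ℝ} {s : ℝ}
    (h : ∀ u, s * (x u * x u) ≤ x u * ∑ w ∈ G.neighborFinset u, x w) :
    s * (x ⬝ᵥ x) ≤ x ⬝ᵥ G.adjMatrix ℝ *ᵥ x := by
  simp only [dotProduct, Finset.mul_sum, SimpleGraph.adjMatrix_mulVec_apply]
  exact Finset.sum_le_sum fun u _ => by simpa only [Finset.mul_sum] using h u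

/-- If every vertex starts at least `k` walks of length two, then the positive vector
`deg + √k` has Rayleigh quotient at least `√k`. -/
theorem exists_pos_vector [Fintype V] [DecidableRel G.Adj] {k : ℕ} (hk : 0 < k)
    (h : ∀ v, k ≤ ∑ u ∈ G.neighborFinset v, G.degree u) :
    ∃ x : V → ℝ, (∀ v, 0 < x v) ∧ √k * (x ⬝ᵥ x) ≤ x ⬝ᵥ G.adjMatrix ℝ *ᵥ x := by
  have hs : (0 : ℝ) < √k := Real.sqrt_pos.2 (by exact_mod_cast hk)
  have hss : √(k : ℝ) * √k = k := Real.mul_self_sqrt (Nat.cast_nonneg k)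
  refine ⟨fun v => G.degree v + √k, fun v => by positivity,
    mul_dotProduct_self_le_of_forall G fun v => ?_⟩
  have hv : (k : ℝ) ≤ ∑ u ∈ G.neighborFinset v, (G.degree u : ℝ) := by exact_mod_cast h v
  rw [Finset.sum_add_distrib, Finset.sum_const, SimpleGraph.card_neighborFinset_eq_degree,
    nsmul_eq_mul]
  have h0 : (0 : ℝ) ≤ G.degree v + √k := by positivity
  nlinarith [mul_le_mul_of_nonneg_left hv h0]

/-- Two vertex-disjoint complete bipartite subgraphs. -/
theorem card_mul_add_card_mul_le_sPlus [Fintype V] [DecidableEq V] [DecidableRel G.Adj]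
    {P Q P' Q' : Finset V} (hP : P.Nonempty) (hQ : Q.Nonempty)
    (hP' : P'.Nonempty) (hQ' : Q'.Nonempty) (hdisj : Disjoint (P ∪ Q) (P' ∪ Q'))
    (h : ∀ p ∈ P, ∀ q ∈ Q, G.Adj p q) (h' : ∀ p ∈ P', ∀ q ∈ Q', G.Adj p q) :
    (P.card * Q.card + P'.card * Q'.card : ℝ) ≤ sPlus G := by
  have aux {P Q : Finset V} (hP : P.Nonempty) (hQ : Q.Nonempty)
      (h : ∀ p ∈ P, ∀ q ∈ Q, G.Adj p q) :
      ∃ x : V → ℝ, (∀ v ∉ P ∪ Q, x v = 0) ∧ 0 < x ⬝ᵥ x ∧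
        √(P.card * Q.card) * (x ⬝ᵥ x) ≤ x ⬝ᵥ G.adjMatrix ℝ *ᵥ x := by
    have hdis {v : V} (hv : v ∈ P) (hv' : v ∈ Q) : False := G.loopless.irrefl v (h v hv v hv')
    have hp : (0 : ℝ) < √P.card := Real.sqrt_pos.2 (by exact_mod_cast hP.card_pos)
    have hq : (0 : ℝ) < √Q.card := Real.sqrt_pos.2 (by exact_mod_cast hQ.card_pos)
    have hpp : √(P.card : ℝ) * √P.card = P.card := Real.mul_self_sqrt (Nat.cast_nonneg _)
    have hqq : √(Q.card : ℝ) * √Q.card = Q.card := Real.mul_self_sqrt (Nat.cast_nonneg _)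
    set x : V → ℝ := fun v => if v ∈ P then √Q.card else if v ∈ Q then √P.card else 0 with hx
    have hx0 (v : V) : 0 ≤ x v := by simp only [hx]; split_ifs <;> positivity
    have hxP {v : V} (hv : v ∈ P) : x v = √Q.card := by simp [hx, hv]
    have hxQ {v : V} (hv : v ∈ Q) : x v = √P.card := by
      have hvP : v ∉ P := fun hv' => hdis hv' hv
      simp [hx, hv, hvP]
    obtain ⟨p, hpP⟩ := hP
    refine ⟨x, fun v hv => ?_, dotProduct_self_pos (u := p) (by rw [hxP hpP]; exact hq.ne'),
      mul_dotProduct_self_le_of_forall G fun v => ?_⟩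
    · simp only [Finset.mem_union, not_or] at hv
      simp [hx, hv.1, hv.2]
    · rw [Real.sqrt_mul (Nat.cast_nonneg _), mul_left_comm]
      refine mul_le_mul_of_nonneg_left ?_ (hx0 v)
      have sub {S : Finset V} (hS : ∀ w ∈ S, G.Adj v w) :
          ∑ w ∈ S, x w ≤ ∑ w ∈ G.neighborFinset v, x w :=
        Finset.sum_le_sum_of_subset_of_nonneg (fun w hw => by simpa using hS w hw)
          fun w _ _ => hx0 w
      by_cases hvP : v ∈ P
      · refine le_trans (le_of_eq ?_) (sub (h v hvP))
        rw [Finset.sum_congr rfl fun w hw => hxQ hw, hxP hvP, Finset.sum_const, nsmul_eq_mul,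
          mul_assoc, hqq, mul_comm]
      by_cases hvQ : v ∈ Q
      · refine le_trans (le_of_eq ?_) (sub fun w hw => (h w hw v hvQ).symm)
        rw [Finset.sum_congr rfl fun w hw => hxP hw, hxQ hvQ, Finset.sum_const, nsmul_eq_mul,
          mul_right_comm, hpp]
      · simpa [hx, hvP, hvQ] using Finset.sum_nonneg fun w _ => hx0 w
  obtain ⟨x, hx0, hx, hxs⟩ := aux hP hQ h
  obtain ⟨y, hy0, hy, hys⟩ := aux hP' hQ' h'
  have hxy : x ⬝ᵥ y = 0 := Finset.sum_eq_zero fun v _ => by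
    by_cases hv : v ∈ P ∪ Q
    · rw [hy0 v (Finset.disjoint_left.1 hdisj hv), mul_zero]
    · rw [hx0 v hv, zero_mul]
  have := sq_add_sq_le_sPlus G (Real.sqrt_nonneg _) (Real.sqrt_nonneg _) hx hy hxy hxs hys
  rwa [Real.sq_sqrt (by positivity), Real.sq_sqrt (by positivity)] at this

/-- An induced `2K₂` raises the bound coming from two-step walks by one. -/
theorem add_one_le_sPlus_of_induced_two_edges [Fintype V] [DecidableEq V] [DecidableRel G.Adj]
    {k : ℕ} (hk : 0 < k)
    (h : ∀ v, k ≤ ∑ u ∈ G.neighborFinset v, G.degree u) {a b c d : V}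
    (hab : G.Adj a b) (hcd : G.Adj c d) (hac : ¬ G.Adj a c) (had : ¬ G.Adj a d)
    (hbc : ¬ G.Adj b c) (hbd : ¬ G.Adj b d) : (k + 1 : ℝ) ≤ sPlus G := by
  obtain ⟨x, hx0, hx⟩ := exists_pos_vector G hk h
  have nac : a ≠ c := by rintro rfl; exact hbc hab.symm
  have nad : a ≠ d := by rintro rfl; exact hbd hab.symm
  have nbc : b ≠ c := by rintro rfl; exact hac hab
  have nbd : b ≠ d := by rintro rfl; exact had hab
  have nab := hab.ne
  have ncd := hcd.ne
  set β := x c + x d with hβ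
  set γ := x a + x b with hγ
  have hβ0 : 0 < β := add_pos (hx0 c) (hx0 d)
  set y : V → ℝ := Pi.single a β + Pi.single b β - Pi.single c γ - Pi.single d γ with hy
  have ya : y a = β := by simp [hy, nab, nac, nad]
  have yb : y b = β := by simp [hy, nab.symm, nbc, nbd]
  have yc : y c = -γ := by simp [hy, nac.symm, nbc.symm, ncd]
  have yd : y d = -γ := by simp [hy, nad.symm, nbd.symm, ncd.symm]
  have dot (z : V → ℝ) : y ⬝ᵥ z = β * z a + β * z b - γ * z c - γ * z d := by
    simp [hy, add_dotProduct, sub_dotProduct]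
  have nb (u : V) : ∑ w ∈ G.neighborFinset u, y w = (if G.Adj u a then β else 0) +
      (if G.Adj u b then β else 0) - (if G.Adj u c then γ else 0) -
      (if G.Adj u d then γ else 0) := by
    simp [hy, Finset.sum_add_distrib, Finset.sum_sub_distrib]
  have hxy : x ⬝ᵥ y = 0 := by rw [dotProduct_comm, dot]; simp only [hβ, hγ]; ring
  have hys : 1 * (y ⬝ᵥ y) ≤ y ⬝ᵥ G.adjMatrix ℝ *ᵥ y := by
    rw [dot, dot]
    simp only [SimpleGraph.adjMatrix_mulVec_apply, nb, ya, yb, yc, yd]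
    simp [hab, hab.symm, hcd, hcd.symm, hac, had, hbc, hbd, G.adj_comm c, G.adj_comm d]
  have := sq_add_sq_le_sPlus G (Real.sqrt_nonneg k) zero_le_one
    (dotProduct_self_pos (hx0 a).ne') (dotProduct_self_pos (u := a) (by rw [ya]; exact hβ0.ne'))
    hxy hx hys
  rwa [Real.sq_sqrt (Nat.cast_nonneg k), one_pow] at this

/-- A graph with a dominating vertex that is not a star. -/
theorem card_le_sPlus_of_dominating [Fintype V] [DecidableEq V] [DecidableRel G.Adj]
    {c a b : V} (hc : ∀ v, v ≠ c → G.Adj c v)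
    (hac : a ≠ c) (hbc : b ≠ c) (hab : G.Adj a b) : (Fintype.card V : ℝ) ≤ sPlus G := by
  obtain ⟨m, hm⟩ : ∃ m, Fintype.card V = m + 1 :=
    ⟨_, (Nat.succ_pred_eq_of_pos (Fintype.card_pos_iff.2 ⟨c⟩)).symm⟩
  have hcard : (Finset.univ.erase c).card = m := by
    rw [Finset.card_erase_of_mem (Finset.mem_univ c), Finset.card_univ, hm]; rfl
  have hm1 : 1 ≤ m := hcard ▸ Finset.card_pos.2 ⟨a, by simpa using hac⟩
  set s := √(m : ℝ) with hs
  have hss : s ^ 2 = m := Real.sq_sqrt (Nat.cast_nonneg m)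
  have hs1 : 1 ≤ s := Real.one_le_sqrt.2 (by exact_mod_cast hm1)
  have hs0 : 0 < s := by linarith
  set x : V → ℝ := 1 + Pi.single c (s - 1) with hx
  set y : V → ℝ := Pi.single a 1 + Pi.single b 1 with hy
  have xc : x c = s := by simp [hx]
  have xne {v : V} (hv : v ≠ c) : x v = 1 := by simp [hx, hv]
  have doty (z : V → ℝ) : y ⬝ᵥ z = z a + z b := by simp [hy, add_dotProduct]
  have dotx (z : V → ℝ) : x ⬝ᵥ z = s * z c + ∑ v ∈ Finset.univ.erase c, z v := by
    rw [dotProduct, ← Finset.add_sum_erase _ _ (Finset.mem_univ c), xc]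
    congr 1
    exact Finset.sum_congr rfl fun v hv => by rw [xne (Finset.ne_of_mem_erase hv), one_mul]
  have hxx : x ⬝ᵥ x = 2 * s ^ 2 := by
    rw [dotx, xc, Finset.sum_congr rfl fun v hv => xne (Finset.ne_of_mem_erase hv),
      Finset.sum_const, hcard, nsmul_eq_mul, hss, ← hss]
    ring
  have hyy : y ⬝ᵥ y = 2 := by
    rw [doty]; simp [hy, hab.ne, hab.ne.symm]; norm_num
  have hxy : x ⬝ᵥ y = 2 := by
    rw [dotProduct_comm, doty, xne hac, xne hbc]; norm_num
  have hyA : 2 ≤ y ⬝ᵥ G.adjMatrix ℝ *ᵥ y := by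
    rw [doty]
    simp only [SimpleGraph.adjMatrix_mulVec_apply]
    simp [hy, Finset.sum_add_distrib, hab, hab.symm]
    norm_num
  have hxA : 2 * s ^ 3 + 2 ≤ x ⬝ᵥ G.adjMatrix ℝ *ᵥ x := by
    have hx0 (v : V) : 0 ≤ x v := by
      by_cases hv : v = c
      · rw [hv, xc]; exact hs0.le
      · rw [xne hv]; exact zero_le_one
    have hNc : G.neighborFinset c = Finset.univ.erase c := by
      ext v; simp only [SimpleGraph.mem_neighborFinset, Finset.mem_erase, Finset.mem_univ, and_true]
      exact ⟨fun h => h.ne', hc v⟩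
    have hle (v : V) (hv : v ∈ Finset.univ.erase c) : s + y v ≤ (G.adjMatrix ℝ *ᵥ x) v := by
      have hvc := Finset.ne_of_mem_erase hv
      have sub {S : Finset V} (hS : ∀ w ∈ S, G.Adj v w) :
          ∑ w ∈ S, x w ≤ ∑ w ∈ G.neighborFinset v, x w :=
        Finset.sum_le_sum_of_subset_of_nonneg (fun w hw => by simpa using hS w hw)
          fun w _ _ => hx0 w
      rw [SimpleGraph.adjMatrix_mulVec_apply]
      by_cases hva : v = a
      · subst hva
        refine le_trans (le_of_eq ?_) (sub (S := {c, b}) (by simp [(hc v hvc).symm, hab]))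
        rw [Finset.sum_pair hbc.symm, xc, xne hbc]; simp [hy, hab.ne]
      by_cases hvb : v = b
      · subst hvb
        refine le_trans (le_of_eq ?_) (sub (S := {c, a}) (by simp [(hc v hvc).symm, hab.symm]))
        rw [Finset.sum_pair hac.symm, xc, xne hac]; simp [hy, hab.ne.symm]
      · refine le_trans (le_of_eq ?_) (sub (S := {c}) (by simp [(hc v hvc).symm]))
        rw [Finset.sum_singleton, xc]; simp [hy, hva, hvb]
    rw [dotx, SimpleGraph.adjMatrix_mulVec_apply, hNc,
      Finset.sum_congr rfl fun v hv => xne (Finset.ne_of_mem_erase hv), Finset.sum_const, hcard,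
      nsmul_eq_mul, ← hss, mul_one]
    have h1 := Finset.sum_le_sum hle
    have h2 : ∑ v ∈ Finset.univ.erase c, y v = 2 := by
      have := hxy
      rw [dotx] at this
      simpa [hy, hac.symm, hbc.symm] using this
    rw [Finset.sum_add_distrib, h2, Finset.sum_const, hcard, nsmul_eq_mul, ← hss] at h1
    linarith
  have hinv : 1 / s ≤ 1 := by rw [div_le_one hs0]; exact hs1
  have key := quad_le_sPlus G x y (α := 1 / (2 * s)) (β := (1 - 1 / s) / 2)
    (by positivity) (by linarith)
  have h1 : s ^ 2 + 1 / s ≤ 1 / (2 * s) * (x ⬝ᵥ G.adjMatrix ℝ *ᵥ x) := by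
    calc s ^ 2 + 1 / s = 1 / (2 * s) * (2 * s ^ 3 + 2) := by field_simp
      _ ≤ _ := by gcongr
  have h2 : 1 - 1 / s ≤ (1 - 1 / s) / 2 * (y ⬝ᵥ G.adjMatrix ℝ *ᵥ y) := by
    nlinarith
  rw [hxx, hyy, hxy] at key
  have h3 : (1 / (2 * s)) ^ 2 * (2 * s ^ 2) ^ 2 = s ^ 2 := by field_simp
  have h4 : 1 / (2 * s) = 1 / s / 2 := by field_simp
  rw [h3] at key
  rw [h4] at key h1
  rw [hm]
  push_cast
  rw [← hss]
  nlinarith [sq_nonneg (1 / s)]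

theorem sum_degree_neighborFinset [Fintype V] [DecidableRel G.Adj]
    (v : V) : ∑ u ∈ G.neighborFinset v, G.degree u =
    ∑ w, ((G.neighborFinset v).filter (G.Adj w)).card := by
  simp only [← SimpleGraph.card_neighborFinset_eq_degree, SimpleGraph.neighborFinset_eq_filter,
    Finset.card_filter]
  rw [Finset.sum_comm]
  simp only [G.adj_comm]

/-- In a graph of diameter at most two, at least `n - 1` walks of length two start at `v`; if there
are no more, then `v` lies on no triangle and no `4`-cycle. -/
theorem card_le_sum_degree_add_one [Fintype V] [DecidableEq V] [DecidableRel G.Adj]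
    (hd : ∀ u w, u ≠ w → ¬ G.Adj u w → ∃ z, G.Adj u z ∧ G.Adj z w) (v : V) :
    Fintype.card V ≤ ∑ u ∈ G.neighborFinset v, G.degree u + 1 ∧
      (∑ u ∈ G.neighborFinset v, G.degree u < Fintype.card V →
        (∀ a b, G.Adj v a → G.Adj v b → ¬ G.Adj a b) ∧
        ∀ w a b, w ≠ v → G.Adj v a → G.Adj v b → G.Adj a w → G.Adj b w → a = b) := by
  set f : V → ℕ := fun w => if w = v then G.degree v else if G.Adj v w then 0 else 1 with hf
  set c : V → ℕ := fun w => ((G.neighborFinset v).filter (G.Adj w)).card with hc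
  have hfc : ∀ w ∈ Finset.univ, f w ≤ c w := by
    intro w _
    simp only [hf]
    split_ifs with h1 h2
    · subst h1
      simp only [hc, ← SimpleGraph.card_neighborFinset_eq_degree]
      exact Finset.card_le_card fun u hu => by simpa using hu
    · exact Nat.zero_le _
    · obtain ⟨z, hvz, hzw⟩ := hd v w (Ne.symm h1) h2
      exact Finset.card_pos.2 ⟨z, by simp [hvz, hzw.symm]⟩
  have hsum : ∑ w, f w + 1 = Fintype.card V := by
    have h1 : ∀ w, f w + ((if w = v then 1 else 0) + (if G.Adj v w then 1 else 0)) =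
        1 + if w = v then G.degree v else 0 := by
      intro w
      simp only [hf]
      split_ifs with h1 h2 h2
      · subst h1; exact absurd h2 (G.loopless.irrefl w)
      all_goals omega
    have h2 := Finset.sum_congr rfl fun w (_ : w ∈ Finset.univ) => h1 w
    simp only [Finset.sum_add_distrib, Finset.sum_ite_eq', Finset.mem_univ, if_true,
      Finset.sum_const, Finset.card_univ, smul_eq_mul, mul_one] at h2
    rw [← Finset.card_filter, ← SimpleGraph.neighborFinset_eq_filter,
      SimpleGraph.card_neighborFinset_eq_degree] at h2
    omega
  rw [sum_degree_neighborFinset]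
  refine ⟨by have := Finset.sum_le_sum hfc; simp only [hc] at this; omega, fun hlt => ?_⟩
  have heq (w : V) : c w ≤ f w := by
    by_contra! h
    have := Finset.sum_lt_sum hfc ⟨w, Finset.mem_univ w, h⟩
    simp only [hc] at this
    omega
  have tri : ∀ a b, G.Adj v a → G.Adj v b → ¬ G.Adj a b := fun a b ha hb hab => by
    have h := heq a
    simp only [hf, hc, ha.ne', ha, if_false, if_true, Nat.le_zero, Finset.card_eq_zero] at h
    exact Finset.notMem_empty b (h ▸ by simp [hb, hab])
  refine ⟨tri, fun w a b hw ha hb haw hbw => ?_⟩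
  have hvw : ¬ G.Adj v w := fun h => tri a w ha h haw
  have h := heq w
  simp only [hf, hc, hw, hvw, if_false] at h
  exact Finset.card_le_one.1 h a (by simp [ha, haw.symm]) b (by simp [hb, hbw.symm])

/-- The `5`-cycle with one vertex doubled has positive square energy at least `6`. -/
theorem six_le_sPlus_of_equiv [Fintype V] [DecidableEq V] [DecidableRel G.Adj] (e : Fin 6 ≃ V)
    (h : ∀ i j, G.Adj (e i) (e j) ↔
      j ∈ (![{1, 5}, {0, 2}, {1, 3, 4}, {2, 5}, {2, 5}, {0, 3, 4}] : Fin 6 → Finset (Fin 6)) i) :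
    6 ≤ sPlus G := by
  have dot (z w : V → ℝ) : z ⬝ᵥ w = ∑ i, z (e i) * w (e i) :=
    (e.sum_comp fun v => z v * w v).symm
  have mv (z : V → ℝ) (i : Fin 6) :
      (G.adjMatrix ℝ *ᵥ z) (e i) = ∑ j, if G.Adj (e i) (e j) then z (e j) else 0 := by
    rw [SimpleGraph.adjMatrix_mulVec_apply, SimpleGraph.neighborFinset_eq_filter,
      Finset.sum_filter]
    exact (e.sum_comp fun v => if G.Adj (e i) v then z v else 0).symm
  have key := sq_add_sq_le_sPlus G (x := ![5, 5, 7, 6, 6, 7] ∘ e.symm)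
    (y := ![-5, -5, 1, 3, 3, 1] ∘ e.symm) (s := 526 / 220) (t := 54 / 70) (by norm_num)
    (by norm_num)
  simp only [dot, mv, h, Function.comp_apply, Equiv.symm_apply_apply, Finset.sum_ite_mem,
    Finset.univ_inter, Fin.sum_univ_succ] at key
  norm_num [Fin.succ] at key
  simp +decide [Finset.sum_insert] at key
  linarith [key (by norm_num) (by norm_num)]

theorem six_le_sPlus_of_doubled_cycle [Fintype V] [DecidableEq V] [DecidableRel G.Adj]
    {v a b p q q' : V}
    (hV : ∀ u, u = v ∨ u = a ∨ u = p ∨ u = q ∨ u = q' ∨ u = b)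
    (hva : G.Adj v a) (hvb : G.Adj v b) (hap : G.Adj a p) (hbq : G.Adj b q) (hbq' : G.Adj b q')
    (hpq : G.Adj p q) (hpq' : G.Adj p q') (hqq' : q ≠ q') (nab : ¬ G.Adj a b) (nvp : ¬ G.Adj v p)
    (nvq : ¬ G.Adj v q) (nvq' : ¬ G.Adj v q') (naq : ¬ G.Adj a q) (naq' : ¬ G.Adj a q')
    (nbp : ¬ G.Adj b p) (nqq' : ¬ G.Adj q q') : 6 ≤ sPlus G := by
  have n1 : v ≠ p := by rintro rfl; exact nbp hvb.symm
  have n2 : v ≠ q := by rintro rfl; exact naq hva.symm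
  have n3 : v ≠ q' := by rintro rfl; exact naq' hva.symm
  have n4 : a ≠ q := by rintro rfl; exact nvq hva
  have n5 : a ≠ q' := by rintro rfl; exact nvq' hva
  have n6 : b ≠ p := by rintro rfl; exact nvp hvb
  have n7 : a ≠ b := by rintro rfl; exact naq hbq
  have hbij : Function.Bijective (![v, a, p, q, q', b] : Fin 6 → V) := by
    refine ⟨fun i j hij => ?_, fun u => ?_⟩
    · have := hva.ne; have := hvb.ne; have := hap.ne; have := hbq.ne; have := hbq'.ne
      have := hpq.ne; have := hpq'.ne
      fin_cases i <;> fin_cases j <;> simp_all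
    · rcases hV u with h | h | h | h | h | h
      exacts [⟨0, h.symm⟩, ⟨1, h.symm⟩, ⟨2, h.symm⟩, ⟨3, h.symm⟩, ⟨4, h.symm⟩, ⟨5, h.symm⟩]
  refine six_le_sPlus_of_equiv G (Equiv.ofBijective _ hbij) fun i j => ?_
  simp only [Equiv.ofBijective_apply]
  fin_cases i <;> fin_cases j <;>
    simp [hva, hvb, hap, hbq, hbq', hpq, hpq', nab, nvp, nvq, nvq', naq, naq', nbp, nqq',
      hva.symm, hvb.symm, hap.symm, hbq.symm, hbq'.symm, hpq.symm, hpq'.symm, G.adj_comm b a,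
      G.adj_comm p v, G.adj_comm q v, G.adj_comm q' v, G.adj_comm q a, G.adj_comm q' a,
      G.adj_comm p b, G.adj_comm q' q]

theorem nonempty_iso_cycleGraph_five {v a b p q : V}
    (hV : ∀ u, u = v ∨ u = a ∨ u = p ∨ u = q ∨ u = b)
    (hva : G.Adj v a) (hvb : G.Adj v b) (hap : G.Adj a p) (hbq : G.Adj b q) (hpq : G.Adj p q)
    (nab : ¬ G.Adj a b) (nvp : ¬ G.Adj v p) (nvq : ¬ G.Adj v q) (naq : ¬ G.Adj a q)
    (nbp : ¬ G.Adj b p) : Nonempty (G ≃g SimpleGraph.cycleGraph 5) := by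
  have n1 : v ≠ p := by rintro rfl; exact nbp hvb.symm
  have n2 : v ≠ q := by rintro rfl; exact naq hva.symm
  have n3 : a ≠ q := by rintro rfl; exact nvq hva
  have n4 : b ≠ p := by rintro rfl; exact nvp hvb
  have n5 : a ≠ b := by rintro rfl; exact naq hbq
  have hbij : Function.Bijective (![v, a, p, q, b] : Fin 5 → V) := by
    refine ⟨fun i j hij => ?_, fun u => ?_⟩
    · have := hva.ne; have := hvb.ne; have := hap.ne; have := hbq.ne; have := hpq.ne
      fin_cases i <;> fin_cases j <;> simp_all
    · rcases hV u with h | h | h | h | h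
      exacts [⟨0, h.symm⟩, ⟨1, h.symm⟩, ⟨2, h.symm⟩, ⟨3, h.symm⟩, ⟨4, h.symm⟩]
  refine ⟨RelIso.symm ⟨Equiv.ofBijective _ hbij, fun {i j} => ?_⟩⟩
  simp only [Equiv.ofBijective_apply]
  fin_cases i <;> fin_cases j <;>
    simp +decide [hva, hvb, hap, hbq, hpq, nab, nvp, nvq, naq, nbp,
      hva.symm, hvb.symm, hap.symm, hbq.symm, hpq.symm, G.adj_comm b a,
      G.adj_comm p v, G.adj_comm q v, G.adj_comm q a, G.adj_comm p b]

theorem nonempty_iso_star [Fintype V] [DecidableEq V] {c : V} (hc : ∀ v, v ≠ c → G.Adj c v)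
    (hind : ∀ a b, a ≠ c → b ≠ c → ¬ G.Adj a b) :
    Nonempty (G ≃g completeBipartiteGraph (Fin 1) (Fin (Fintype.card V - 1))) := by
  have hcard : Fintype.card {v // v ≠ c} = Fintype.card V - 1 := by
    simp [Fintype.card_subtype_compl]
  let e : V ≃ Fin 1 ⊕ Fin (Fintype.card V - 1) :=
    (Equiv.sumCompl (· = c)).symm.trans
      (Equiv.sumCongr (Equiv.ofUnique _ _) (Fintype.equivFinOfCardEq hcard))
  have hl : (e c).isLeft := by
    simp [e, Equiv.sumCompl_symm_apply_of_pos]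
  have hr {v : V} (hv : v ≠ c) : (e v).isRight := by
    simp [e, Equiv.sumCompl_symm_apply_of_neg, hv]
  have hr' {v : V} (hv : v ≠ c) : ¬ (e v).isLeft := by
    have := hr hv
    simpa using this
  have hl' : ¬ (e c).isRight := by simpa using hl
  refine ⟨e, fun {a b} => ?_⟩
  rw [completeBipartiteGraph_adj]
  by_cases ha : a = c <;> by_cases hb : b = c
  · subst ha; subst hb; simp [hl']
  · subst ha; simp [hl, hr hb, hc b hb]
  · subst hb; simp [hl, hr ha, (hc a ha).symm]
  · simp [hr' ha, hr' hb, hind a b ha hb]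

theorem exists_common_neighbor_of_diam_eq_two (hdiam : G.diam = 2) (u w : V) (huw : u ≠ w)
    (hadj : ¬ G.Adj u w) : ∃ z, G.Adj u z ∧ G.Adj z w := by
  have htop : G.ediam ≠ ⊤ := fun h => by simp [SimpleGraph.diam, h] at hdiam
  have hconn : G.Reachable u w := by
    have : Nonempty V := ⟨u⟩
    exact (SimpleGraph.connected_of_ediam_ne_top htop).preconnected u w
  obtain ⟨p, hp⟩ := hconn.exists_walk_length_eq_dist
  have hle : p.length ≤ 2 := hp ▸ hdiam ▸ SimpleGraph.dist_le_diam htop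
  cases p with
  | nil => exact absurd rfl huw
  | cons h q =>
    cases q with
    | nil => exact absurd h hadj
    | cons h' r =>
      have h0 : r.length = 0 := by simp only [SimpleGraph.Walk.length_cons] at hle; omega
      obtain rfl := SimpleGraph.Walk.eq_of_length_eq_zero h0
      exact ⟨_, h, h'⟩

theorem card_cases {p q : ℕ} (hp : 1 ≤ p) (hq : 1 ≤ q) (h : q * (p + 1) + 1 < p + q + 3)
    (h' : p * (q + 1) + 1 < p + q + 3) : p = 1 ∧ q = 1 ∨ p = 1 ∧ q = 2 ∨ p = 2 ∧ q = 1 := by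
  have hp2 : p ≤ 2 := by nlinarith
  have hq2 : q ≤ 2 := by nlinarith
  interval_cases p <;> interval_cases q <;> omega

/-- A blow-up of the `5`-cycle `v a p q b` in which `p` and `q` are replaced by independent sets
`P` and `Q`. -/
theorem card_le_sPlus_of_blowup [Fintype V] [DecidableEq V] [DecidableRel G.Adj]
    (hC5 : IsEmpty (G ≃g SimpleGraph.cycleGraph 5)) {v a b : V}
    {P Q : Finset V} (hP : P.Nonempty) (hQ : Q.Nonempty)
    (cover : ∀ u, u = v ∨ u = a ∨ u = b ∨ u ∈ P ∨ u ∈ Q)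
    (hva : G.Adj v a) (hvb : G.Adj v b) (nab : ¬ G.Adj a b)
    (nP : ∀ {r}, r ∈ P → G.Adj a r ∧ ¬ G.Adj v r ∧ ¬ G.Adj b r)
    (nQ : ∀ {r}, r ∈ Q → G.Adj b r ∧ ¬ G.Adj v r ∧ ¬ G.Adj a r)
    (indP : ∀ {r r'}, r ∈ P → r' ∈ P → ¬ G.Adj r r')
    (indQ : ∀ {r r'}, r ∈ Q → r' ∈ Q → ¬ G.Adj r r')
    (complete : ∀ r ∈ P, ∀ r' ∈ Q, G.Adj r r') : (Fintype.card V : ℝ) ≤ sPlus G := by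
  by_contra hcon
  have haP : a ∉ P := fun h => G.loopless.irrefl a (nP h).1
  have hbQ : b ∉ Q := fun h => G.loopless.irrefl b (nQ h).1
  have haQ : a ∉ Q := fun h => nab (nQ h).1.symm
  have hbP : b ∉ P := fun h => nab (nP h).1
  have hvP : v ∉ P := fun h => (nP h).2.2 hvb.symm
  have hvQ : v ∉ Q := fun h => (nQ h).2.2 hva.symm
  have hba : b ≠ a := by
    rintro rfl
    obtain ⟨q, hq⟩ := hQ
    exact (nQ hq).2.2 (nQ hq).1
  have hPQ : Disjoint P Q := Finset.disjoint_left.2 fun w hp hq =>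
    (nP hp).2.2 (nQ hq).1
  have hcard : Fintype.card V = P.card + Q.card + 3 := by
    have huniv : (Finset.univ : Finset V) = insert v (insert a (insert b (P ∪ Q))) := by
      ext u; simpa using cover u
    rw [← Finset.card_univ, huniv, Finset.card_insert_of_notMem, Finset.card_insert_of_notMem,
      Finset.card_insert_of_notMem, Finset.card_union_of_disjoint hPQ]
    · simp [hbP, hbQ]
    · simp [haP, haQ, hba.symm]
    · simp [hvP, hvQ, hva.ne, hvb.ne]
  have hp1 : 1 ≤ P.card := Finset.card_pos.2 hP
  have hq1 : 1 ≤ Q.card := Finset.card_pos.2 hQ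
  have hb1 : Q.card * (P.card + 1) + 1 < P.card + Q.card + 3 := by
    have h := card_mul_add_card_mul_le_sPlus G (P := Q) (Q := insert b P) (P' := {v}) (Q' := {a})
      hQ ⟨b, Finset.mem_insert_self b P⟩ ⟨v, by simp⟩ ⟨a, by simp⟩
      (by simp [haP, haQ, hvP, hvQ, hba.symm, hvb.ne])
      (fun r hr r' hr' => by
        rcases Finset.mem_insert.1 hr' with rfl | h
        · exact (nQ hr).1.symm
        · exact (complete r' h r hr).symm) (by simpa using hva)
    rw [Finset.card_insert_of_notMem hbP] at h
    have := h.trans_lt (not_le.1 hcon)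
    rw [hcard] at this
    simp only [Finset.card_singleton] at this
    exact_mod_cast this
  have hb2 : P.card * (Q.card + 1) + 1 < P.card + Q.card + 3 := by
    have h := card_mul_add_card_mul_le_sPlus G (P := P) (Q := insert a Q) (P' := {v}) (Q' := {b})
      hP ⟨a, Finset.mem_insert_self a Q⟩ ⟨v, by simp⟩ ⟨b, by simp⟩
      (by simp [hbP, hbQ, hvP, hvQ, hba, hva.ne])
      (fun r hr r' hr' => by
        rcases Finset.mem_insert.1 hr' with rfl | h
        · exact (nP hr).1.symm
        · exact complete r hr r' h) (by simpa using hvb)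
    rw [Finset.card_insert_of_notMem haQ] at h
    have := h.trans_lt (not_le.1 hcon)
    rw [hcard] at this
    simp only [Finset.card_singleton] at this
    exact_mod_cast this
  have hor := card_cases hp1 hq1 hb1 hb2
  have six (h : P.card + Q.card = 3) : ¬ 6 ≤ sPlus G := fun h6 => hcon (by
    rw [hcard, h]; norm_num; exact h6)
  rcases hor with ⟨h1, h2⟩ | ⟨h1, h2⟩ | ⟨h1, h2⟩
  · obtain ⟨p, hp⟩ := Finset.card_eq_one.1 h1
    obtain ⟨q, hq⟩ := Finset.card_eq_one.1 h2
    have hpP : p ∈ P := by simp [hp]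
    have hqQ : q ∈ Q := by simp [hq]
    refine (nonempty_iso_cycleGraph_five G (v := v) (a := a) (b := b) (p := p) (q := q)
      (fun u => ?_) hva hvb (nP hpP).1 (nQ hqQ).1 (complete p hpP q hqQ) nab (nP hpP).2.1
      (nQ hqQ).2.1 (nQ hqQ).2.2 (nP hpP).2.2).elim hC5.elim
    simpa only [hp, hq, Finset.mem_singleton, or_assoc, or_comm, or_left_comm] using cover u
  · obtain ⟨p, hp⟩ := Finset.card_eq_one.1 h1
    obtain ⟨q, q', hne, hq⟩ := Finset.card_eq_two.1 h2
    have hpP : p ∈ P := by simp [hp]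
    have hqQ : q ∈ Q := by simp [hq]
    have hq'Q : q' ∈ Q := by simp [hq]
    refine six (by omega) (six_le_sPlus_of_doubled_cycle G (v := v) (a := a) (b := b) (p := p)
      (q := q) (q' := q') (fun u => ?_) hva hvb (nP hpP).1 (nQ hqQ).1 (nQ hq'Q).1
      (complete p hpP q hqQ) (complete p hpP q' hq'Q) hne nab (nP hpP).2.1
      (nQ hqQ).2.1 (nQ hq'Q).2.1 (nQ hqQ).2.2 (nQ hq'Q).2.2 (nP hpP).2.2 (indQ hqQ hq'Q))
    simpa only [hp, hq, Finset.mem_singleton, Finset.mem_insert, or_assoc, or_comm,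
      or_left_comm] using cover u
  · obtain ⟨q, hq⟩ := Finset.card_eq_one.1 h2
    obtain ⟨p, p', hne, hp⟩ := Finset.card_eq_two.1 h1
    have hqQ : q ∈ Q := by simp [hq]
    have hpP : p ∈ P := by simp [hp]
    have hp'P : p' ∈ P := by simp [hp]
    refine six (by omega) (six_le_sPlus_of_doubled_cycle G (v := v) (a := b) (b := a) (p := q)
      (q := p) (q' := p') (fun u => ?_) hvb hva (nQ hqQ).1 (nP hpP).1 (nP hp'P).1
      (complete p hpP q hqQ).symm (complete p' hp'P q hqQ).symm hne (fun h => nab h.symm)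
      (nQ hqQ).2.1 (nP hpP).2.1 (nP hp'P).2.1 (nP hpP).2.2 (nP hp'P).2.2 (nQ hqQ).2.2
      (indP hpP hp'P))
    simpa only [hp, hq, Finset.mem_singleton, Finset.mem_insert, or_assoc, or_comm,
      or_left_comm] using cover u

/-- If few walks of length two start at `v`, then `G` is obtained from a `5`-cycle `v a p q b` by
multiplying the vertices `p` and `q`, unless it has a dominating vertex or an induced `2K₂`. -/
theorem card_le_sPlus_of_few_walks [Fintype V] [DecidableEq V] [DecidableRel G.Adj]
    (hC5 : IsEmpty (G ≃g SimpleGraph.cycleGraph 5))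
    (hd : ∀ u w, u ≠ w → ¬ G.Adj u w → ∃ z, G.Adj u z ∧ G.Adj z w)
    (hdom : ∀ c, ∃ v, v ≠ c ∧ ¬ G.Adj c v) {v : V}
    (hv : ∑ u ∈ G.neighborFinset v, G.degree u < Fintype.card V) :
    (Fintype.card V : ℝ) ≤ sPlus G := by
  by_contra hcon
  obtain ⟨tri, sq⟩ := (card_le_sum_degree_add_one G hd v).2 hv
  obtain ⟨w₀, hw₀, hvw₀⟩ := hdom v
  have noK2 {a b c d : V} (hab : G.Adj a b) (hcd : G.Adj c d) (hac : ¬ G.Adj a c)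
      (had : ¬ G.Adj a d) (hbc : ¬ G.Adj b c) (hbd : ¬ G.Adj b d) : False := by
    have hpos : 1 < Fintype.card V := Fintype.one_lt_card_iff.2 ⟨a, b, hab.ne⟩
    have := add_one_le_sPlus_of_induced_two_edges G (k := Fintype.card V - 1) (by omega)
      (fun u => by have := (card_le_sum_degree_add_one G hd u).1; omega) hab hcd hac had hbc hbd
    rw [Nat.cast_sub hpos.le, Nat.cast_one, sub_add_cancel] at this
    exact hcon this
  obtain ⟨a, hva, haw₀⟩ := hd v w₀ hw₀.symm hvw₀
  obtain ⟨b, hvb, hba⟩ : ∃ b, G.Adj v b ∧ b ≠ a := by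
    obtain ⟨z, hza, haz⟩ := hdom a
    by_cases hvz : G.Adj v z
    · exact ⟨z, hvz, hza⟩
    · have hzv : z ≠ v := by rintro rfl; exact haz hva.symm
      obtain ⟨b, hvb, hbz⟩ := hd v z hzv.symm hvz
      exact ⟨b, hvb, by rintro rfl; exact haz hbz⟩
  have nab : ¬ G.Adj a b := tri a b hva hvb
  have uniq {w : V} (hw : w ≠ v) (ha : G.Adj a w) : ¬ G.Adj b w := fun hb =>
    hba (sq w b a hw hvb hva hb ha)
  have far {x w : V} (hx : G.Adj v x) (h : G.Adj x w) : ¬ G.Adj v w := fun hw => tri x w hx hw h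
  obtain ⟨y₀, hy₀, hby₀, hwy₀⟩ : ∃ y, y ≠ v ∧ G.Adj b y ∧ G.Adj w₀ y := by
    have hne : b ≠ w₀ := by rintro rfl; exact hvw₀ hvb
    obtain ⟨y, hby, hyw⟩ := hd b w₀ hne (uniq hw₀ haw₀)
    exact ⟨y, by rintro rfl; exact hvw₀ hyw, hby, hyw.symm⟩
  have hN {x : V} (hx : G.Adj v x) : x = a ∨ x = b := by
    by_contra! h
    exact noK2 hx hwy₀ hvw₀ (far hvb hby₀)
      (fun h' => h.1 (sq w₀ x a hw₀ hx hva h' haw₀)) (fun h' => h.2 (sq y₀ x b hy₀ hx hvb h' hby₀))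
  set P := (G.neighborFinset a).erase v with hP
  set Q := (G.neighborFinset b).erase v with hQ
  have memP {w : V} : w ∈ P ↔ w ≠ v ∧ G.Adj a w := by simp [hP]
  have memQ {w : V} : w ∈ Q ↔ w ≠ v ∧ G.Adj b w := by simp [hQ]
  have hw₀P : w₀ ∈ P := memP.2 ⟨hw₀, haw₀⟩
  have hy₀Q : y₀ ∈ Q := memQ.2 ⟨hy₀, hby₀⟩
  have cover (u : V) : u = v ∨ u = a ∨ u = b ∨ u ∈ P ∨ u ∈ Q := by
    by_cases huv : u = v
    · exact Or.inl huv
    by_cases hu : G.Adj v u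
    · rcases hN hu with h | h <;> simp [h]
    · obtain ⟨z, hvz, hzu⟩ := hd v u (Ne.symm huv) hu
      rcases hN hvz with rfl | rfl
      · exact Or.inr (Or.inr (Or.inr (Or.inl (memP.2 ⟨huv, hzu⟩))))
      · exact Or.inr (Or.inr (Or.inr (Or.inr (memQ.2 ⟨huv, hzu⟩))))
  have indP {r r' : V} (hr : r ∈ P) (hr' : r' ∈ P) : ¬ G.Adj r r' := fun h => by
    rw [memP] at hr hr'
    exact noK2 hvb h (far hva hr.2) (far hva hr'.2) (uniq hr.1 hr.2) (uniq hr'.1 hr'.2)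
  have indQ {r r' : V} (hr : r ∈ Q) (hr' : r' ∈ Q) : ¬ G.Adj r r' := fun h => by
    rw [memQ] at hr hr'
    exact noK2 hva h (far hvb hr.2) (far hvb hr'.2) (fun h' => uniq hr.1 h' hr.2)
      (fun h' => uniq hr'.1 h' hr'.2)
  have complete (r : V) (hr : r ∈ P) (r' : V) (hr' : r' ∈ Q) : G.Adj r r' := by
    by_contra h
    have hr₂ := memP.1 hr
    have hr'₂ := memQ.1 hr'
    have hne : r ≠ r' := by rintro rfl; exact uniq hr₂.1 hr₂.2 hr'₂.2
    obtain ⟨z, hrz, hzr'⟩ := hd r r' hne h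
    rcases cover z with rfl | rfl | rfl | hz | hz
    · exact far hva hr₂.2 hrz.symm
    · exact uniq hr'₂.1 hzr' hr'₂.2
    · exact uniq hr₂.1 hr₂.2 hrz.symm
    · exact indP hr hz hrz
    · exact indQ hz hr' hzr'
  have nP {r : V} (hr : r ∈ P) : G.Adj a r ∧ ¬ G.Adj v r ∧ ¬ G.Adj b r :=
    have h := memP.1 hr
    ⟨h.2, far hva h.2, uniq h.1 h.2⟩
  have nQ {r : V} (hr : r ∈ Q) : G.Adj b r ∧ ¬ G.Adj v r ∧ ¬ G.Adj a r :=
    have h := memQ.1 hr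
    ⟨h.2, far hvb h.2, fun h' => uniq h.1 h' h.2⟩
  exact hcon (card_le_sPlus_of_blowup G hC5 ⟨w₀, hw₀P⟩ ⟨y₀, hy₀Q⟩ cover hva hvb nab nP nQ indP indQ
    complete)

end

/-- A graph of order `n` with diameter exactly `2` which is not a star `K_{1,n-1}` and not a
`5`-cycle satisfies `s⁺(G) ≥ n`. -/
theorem stmt_1 {V : Type*} [Fintype V] [DecidableEq V] (G : SimpleGraph V) [DecidableRel G.Adj]
    (hdiam : G.diam = 2)
    (hstar : IsEmpty (G ≃g completeBipartiteGraph (Fin 1) (Fin (Fintype.card V - 1))))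
    (hC5 : IsEmpty (G ≃g SimpleGraph.cycleGraph 5)) :
    (Fintype.card V : ℝ) ≤ sPlus G := by
  have hd := exists_common_neighbor_of_diam_eq_two G hdiam
  by_cases hdom : ∀ c, ∃ v, v ≠ c ∧ ¬ G.Adj c v
  · by_cases hw : ∃ v, ∑ u ∈ G.neighborFinset v, G.degree u < Fintype.card V
    · obtain ⟨v, hv⟩ := hw
      exact card_le_sPlus_of_few_walks G hC5 hd hdom hv
    · push Not at hw
      cases isEmpty_or_nonempty V with
      | inl h =>
        have : G.ediam = 0 := SimpleGraph.ediam_eq_zero_of_subsingleton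
        simp [SimpleGraph.diam, this] at hdiam
      | inr h =>
        obtain ⟨x, hx0, hx⟩ := exists_pos_vector G Fintype.card_pos hw
        have := sq_le_sPlus G (Real.sqrt_nonneg _)
          (dotProduct_self_pos (hx0 (Classical.arbitrary V)).ne') hx
        rwa [Real.sq_sqrt (Nat.cast_nonneg _)] at this
  · push Not at hdom
    obtain ⟨c, hc⟩ := hdom
    by_cases h : ∃ a b, a ≠ c ∧ b ≠ c ∧ G.Adj a b
    · obtain ⟨a, b, hac, hbc, hab⟩ := h
      exact card_le_sPlus_of_dominating G hc hac hbc hab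
    · push Not at h
      exact (nonempty_iso_star G hc h).elim hstar.elim

end SquareEnergy
end

section
/- Let G be a connected simple graph of order n with domination number γ(G) = 2. Then s⁺(G) ≥ n − 1. -/
open Matrix

namespace SquareEnergy

/-- `S` is a dominating set of `G`: every vertex outside `S` has a neighbour in `S`. -/
def IsDominatingSet {V : Type*} (G : SimpleGraph V) (S : Finset V) : Prop :=
  ∀ v : V, v ∉ S → ∃ u ∈ S, G.Adj u v

/-- The domination number of `G`: the minimum size of a dominating set. -/
noncomputable def dominationNumber {V : Type*} (G : SimpleGraph V) : ℕ :=
  sInf {k : ℕ | ∃ S : Finset V, S.card = k ∧ IsDominatingSet G S}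

/-- Variational lower bound for the sum of squares of the positive eigenvalues. -/
theorem two_mul_trace_sub_trace_sq_le {V : Type*} [Fintype V] [DecidableEq V]
    {A X : Matrix V V ℝ} (hA : A.IsHermitian) (hX : X.PosSemidef) :
    2 * (A * X).trace - (X * X).trace ≤
      ∑ i, if 0 < hA.eigenvalues i then hA.eigenvalues i ^ 2 else 0 := by
  set U : Matrix V V ℝ := (hA.eigenvectorUnitary : Matrix V V ℝ) with hU
  have hUU : U * star U = 1 := Unitary.coe_mul_star_self hA.eigenvectorUnitary
  have hspec : A = U * diagonal hA.eigenvalues * star U := by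
    conv_lhs => rw [hA.spectral_theorem]
    simp [Unitary.conjStarAlgAut_apply, hU]
  set Y : Matrix V V ℝ := star U * X * U with hY
  have hYpos : Y.PosSemidef := hX.conjTranspose_mul_mul_same U
  have h1 : (A * X).trace = ∑ i, hA.eigenvalues i * Y i i := by
    have : (A * X).trace = (diagonal hA.eigenvalues * Y).trace := by
      conv_lhs => rw [hspec]
      rw [hY, Matrix.mul_assoc, Matrix.mul_assoc, Matrix.trace_mul_comm]
      simp only [Matrix.mul_assoc]
    rw [this]
    simp [Matrix.trace, Matrix.diagonal_mul]
  have h2 : (X * X).trace = (Y * Y).trace := by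
    have : Y * Y = star U * (X * X * U) := by
      calc Y * Y = star U * X * (U * star U) * X * U := by simp only [hY, Matrix.mul_assoc]
        _ = _ := by rw [hUU]; simp only [Matrix.mul_assoc, Matrix.one_mul]
    rw [this, Matrix.trace_mul_comm (star U), Matrix.mul_assoc (X * X), hUU, Matrix.mul_one]
  have h3 : ∑ i, Y i i ^ 2 ≤ (Y * Y).trace := by
    simp only [Matrix.trace, Matrix.diag, Matrix.mul_apply]
    refine Finset.sum_le_sum fun i _ => ?_
    have hs : ∀ j, Y i j * Y j i = Y i j ^ 2 := fun j => by
      have := hYpos.1.apply i j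
      simp only [star_trivial] at this
      rw [this, sq]
    simp only [hs]
    exact Finset.single_le_sum (f := fun j => Y i j ^ 2) (fun j _ => sq_nonneg _)
      (Finset.mem_univ i)
  have h4 : ∀ i, 2 * (hA.eigenvalues i * Y i i) - Y i i ^ 2 ≤
      if 0 < hA.eigenvalues i then hA.eigenvalues i ^ 2 else 0 := fun i => by
    have := hYpos.diag_nonneg (i := i)
    split_ifs with h
    · nlinarith [sq_nonneg (hA.eigenvalues i - Y i i)]
    · nlinarith [sq_nonneg (Y i i)]
  calc _ ≤ 2 * ∑ i, hA.eigenvalues i * Y i i - ∑ i, Y i i ^ 2 := by rw [h1, h2]; linarith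
    _ = ∑ i, (2 * (hA.eigenvalues i * Y i i) - Y i i ^ 2) := by
      rw [Finset.mul_sum, Finset.sum_sub_distrib]
    _ ≤ _ := Finset.sum_le_sum fun i _ => h4 i

theorem two_mul_sum_sub_sum_sq_le_sPlus {V : Type*} [Fintype V] [DecidableEq V]
    (G : SimpleGraph V) [DecidableRel G.Adj] {X : Matrix V V ℝ} (hX : X.PosSemidef) :
    2 * ∑ a, ∑ b, G.adjMatrix ℝ a b * X a b - ∑ a, ∑ b, X a b ^ 2 ≤ sPlus G := by
  have h := two_mul_trace_sub_trace_sq_le (adj_isHermitian G) hX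
  have hs : ∀ a b, X b a = X a b := fun a b => by simpa using hX.1.apply a b
  simp only [Matrix.trace, Matrix.diag, Matrix.mul_apply, hs, ← sq] at h
  unfold sPlus adjEig
  convert h

/-- Lower bound from a nonnegative combination of rank one matrices. -/
theorem sum_rankOne_le_sPlus {V ι : Type*} [Fintype V] [DecidableEq V] [Fintype ι]
    (G : SimpleGraph V) [DecidableRel G.Adj] (t : ι → ℝ) (ht : ∀ i, 0 ≤ t i) (z : ι → V → ℝ) :
    2 * ∑ i, t i * (z i ⬝ᵥ G.adjMatrix ℝ *ᵥ z i) - ∑ i, ∑ j, t i * t j * (z i ⬝ᵥ z j) ^ 2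
      ≤ sPlus G := by
  have hX : (∑ i, t i • vecMulVec (z i) (z i)).PosSemidef :=
    posSemidef_sum _ fun i _ => by
      simpa using (posSemidef_vecMulVec_self_star (z i)).smul (ht i)
  refine le_of_eq_of_le ?_ (two_mul_sum_sub_sum_sq_le_sPlus G hX)
  simp only [Matrix.sum_apply, Matrix.smul_apply, vecMulVec_apply, smul_eq_mul]
  congr 1
  · congr 1
    simp only [dotProduct, mulVec, Finset.mul_sum]
    rw [Finset.sum_comm]
    refine Finset.sum_congr rfl fun a _ => ?_
    rw [Finset.sum_comm]
    refine Finset.sum_congr rfl fun b _ => Finset.sum_congr rfl fun i _ => ?_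
    ring
  · simp only [dotProduct, sq, Finset.sum_mul_sum]
    simp only [Finset.mul_sum]
    have hc : ∀ f : ι → ι → V → V → ℝ,
        ∑ i, ∑ j, ∑ a, ∑ b, f i j a b = ∑ a, ∑ b, ∑ i, ∑ j, f i j a b := fun f => by
      calc _ = ∑ i, ∑ a, ∑ j, ∑ b, f i j a b :=
            Finset.sum_congr rfl fun i _ => Finset.sum_comm
        _ = ∑ i, ∑ a, ∑ b, ∑ j, f i j a b :=
            Finset.sum_congr rfl fun i _ => Finset.sum_congr rfl fun a _ => Finset.sum_comm
        _ = ∑ a, ∑ i, ∑ b, ∑ j, f i j a b := Finset.sum_comm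
        _ = _ := Finset.sum_congr rfl fun a _ => Finset.sum_comm
    rw [hc]
    refine Finset.sum_congr rfl fun a _ => Finset.sum_congr rfl fun b _ =>
      Finset.sum_congr rfl fun i _ => Finset.sum_congr rfl fun j _ => ?_
    ring

section Bipartite

open scoped MatrixOrder Matrix.Norms.L2Operator

/-- The absolute value of a symmetric matrix supported on pairs of opposite sign is supported
on pairs of equal sign. -/
theorem exists_abs_of_bipartite {ι : Type*} [Fintype ι] [DecidableEq ι] {H : Matrix ι ι ℝ}
    (hH : H.IsHermitian) (ε : ι → ℝ) (hε : ∀ i, ε i * ε i = 1)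
    (hHε : ∀ i j, ε i * H i j * ε j = -H i j) :
    ∃ S : Matrix ι ι ℝ, S.PosSemidef ∧ (S + H).PosSemidef ∧ S * S = H * H ∧
      ∀ i j, ε i * S i j * ε j = S i j := by
  have hsa : IsSelfAdjoint H := hH
  have hS : (CFC.abs H).PosSemidef := nonneg_iff_posSemidef.1 (CFC.abs_nonneg H)
  have hSS : CFC.abs H * CFC.abs H = H * H := by rw [CFC.abs_mul_abs, hsa.star_eq]
  refine ⟨CFC.abs H, hS, ?_, hSS, ?_⟩
  · rw [CFC.abs_add_self H hsa, ← nonneg_iff_posSemidef]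
    exact nsmul_nonneg (CFC.posPart_nonneg H) 2
  · set D : Matrix ι ι ℝ := diagonal ε with hD
    have hDD : D * D = 1 := by simp [hD, hε]
    have hDH : D * H * D = -H := by
      ext i j
      simp [hD, hHε]
    have hpos : (D * CFC.abs H * D).PosSemidef := by
      have := hS.conjTranspose_mul_mul_same D
      rwa [hD, diagonal_conjTranspose, star_trivial] at this
    have hsq : D * CFC.abs H * D * (D * CFC.abs H * D) = H * H := by
      calc _ = D * CFC.abs H * (D * D) * CFC.abs H * D := by simp only [Matrix.mul_assoc]
        _ = D * (CFC.abs H * CFC.abs H) * D := by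
          rw [hDD]; simp only [Matrix.mul_assoc, Matrix.one_mul]
        _ = D * H * (D * D) * H * D := by
          rw [hSS, hDD]; simp only [Matrix.mul_assoc, Matrix.one_mul]
        _ = (D * H * D) * (D * H * D) := by simp only [Matrix.mul_assoc]
        _ = H * H := by rw [hDH]; simp
    have h1 := CFC.sqrt_unique hsq (nonneg_iff_posSemidef.2 hpos)
    have h2 := CFC.sqrt_unique hSS (nonneg_iff_posSemidef.2 hS)
    have h3 := h1.symm.trans h2
    intro i j
    have := congrFun (congrFun h3 i) j
    simpa [hD] using this

end Bipartite

theorem apply_sq_le_of_posSemidef {ι : Type*} [Fintype ι] {S : Matrix ι ι ℝ}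
    (hS : S.PosSemidef) (i j : ι) : S i j ^ 2 ≤ S i i * S j j := by
  have h := (hS.submatrix ![i, j]).det_nonneg
  have hs : S j i = S i j := by simpa using hS.1.apply i j
  rw [det_fin_two] at h
  simp [hs] at h
  nlinarith

theorem sqrt_jacobi_last_nonneg {a b c d e f : ℝ} (ha : 0 ≤ a) (hc : 0 ≤ c)
    (hd : d ^ 2 ≤ a * b) (he : e ^ 2 ≤ b * c) (hf : f * (a + c) + d * e = 0)
    (h : 0 ≤ e * (b + c) + d * f) : 0 ≤ e := by
  rcases hc.eq_or_lt with rfl | hc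
  · nlinarith
  · by_contra! hneg
    have h1 : 0 ≤ (e * (b + c) + d * f) * (a + c) := mul_nonneg h (by positivity)
    have h2 : (e * (b + c) + d * f) * (a + c) = e * ((b + c) * (a + c) - d ^ 2) := by
      linear_combination d * hf
    have h3 : 0 < (b + c) * (a + c) - d ^ 2 := by
      nlinarith [mul_nonneg ha hc.le, sq_nonneg d]
    nlinarith

/-- If the square of a positive semidefinite `3 × 3` matrix is a nonnegative Jacobi matrix, then
the entries next to the diagonal of the matrix are nonnegative. -/
theorem sqrt_jacobi_offDiag_nonneg {a b c d e f : ℝ} (ha : 0 ≤ a) (hc : 0 ≤ c)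
    (hd : d ^ 2 ≤ a * b) (he : e ^ 2 ≤ b * c) (hf : f * (a + c) + d * e = 0)
    (h12 : 0 ≤ d * (a + b) + f * e) (h23 : 0 ≤ e * (b + c) + d * f) : 0 ≤ d ∧ 0 ≤ e :=
  ⟨sqrt_jacobi_last_nonneg (b := b) (d := e) (f := f) hc ha (by linarith) (by linarith)
    (by linarith) (by linarith), sqrt_jacobi_last_nonneg ha hc hd he hf h23⟩

/-- The weighted adjacency matrix of a path on six vertices with weights `r i * r (i + 1)`. -/
def pathMatrix (r : Fin 6 → ℝ) : Matrix (Fin 6) (Fin 6) ℝ :=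
  fun i j => if i.val + 1 = j.val ∨ j.val + 1 = i.val then r i * r j else 0

theorem isHermitian_pathMatrix (r : Fin 6 → ℝ) : (pathMatrix r).IsHermitian := by
  ext i j
  simp only [conjTranspose_apply, pathMatrix, star_trivial, or_comm, mul_comm]

theorem exists_abs_pathMatrix (r : Fin 6 → ℝ) (hr : ∀ i, 0 ≤ r i) :
    ∃ S : Matrix (Fin 6) (Fin 6) ℝ, S.PosSemidef ∧ (S + pathMatrix r).PosSemidef ∧
      S * S = pathMatrix r * pathMatrix r ∧
      (∀ i j : Fin 6, (i.val + j.val) % 2 = 1 → S i j = 0) ∧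
      ∀ i j : Fin 6, i.val + 4 ≠ j.val → j.val + 4 ≠ i.val → 0 ≤ S i j := by
  obtain ⟨S, hS, hSH, hSS, hε⟩ := exists_abs_of_bipartite (isHermitian_pathMatrix r) (fun i => (-1) ^ i.val)
    (fun i => by rw [← mul_pow]; simp) (by
      intro i j
      fin_cases i <;> fin_cases j <;> norm_num [pathMatrix])
  have hsym : ∀ i j, S j i = S i j := fun i j => by simpa using hS.1.apply i j
  have hodd : ∀ i j : Fin 6, (i.val + j.val) % 2 = 1 → S i j = 0 := by
    intro i j hij
    have h := hε i j
    have : ((-1 : ℝ)) ^ i.val * (-1) ^ j.val = -1 := by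
      rw [← pow_add]; exact Odd.neg_one_pow (Nat.odd_iff.2 hij)
    have h' : (-1 : ℝ) ^ i.val * S i j * (-1) ^ j.val = -S i j := by
      linear_combination S i j * this
    linarith
  have hsq : ∀ i j, ∑ k, S i k * S k j = ∑ k, pathMatrix r i k * pathMatrix r k j := by
    intro i j
    have := congrFun (congrFun hSS i) j
    simpa [Matrix.mul_apply] using this
  have hdiag : ∀ i, 0 ≤ S i i := fun i => hS.diag_nonneg
  have hmin := apply_sq_le_of_posSemidef hS
  have hprod : ∀ i j k l, 0 ≤ r i * r j * (r k * r l) := fun i j k l => by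
    have := hr i; have := hr j; have := hr k; have := hr l; positivity
  have heven : 0 ≤ S 0 2 ∧ 0 ≤ S 2 4 := by
    have h02 := hsq 0 2
    have h24 := hsq 2 4
    have h04 := hsq 0 4
    simp [Fin.sum_univ_six, pathMatrix, hodd, hsym 0 2, hsym 2 4] at h02 h24 h04
    refine sqrt_jacobi_offDiag_nonneg (hdiag 0) (hdiag 4) (hmin 0 2) (hmin 2 4)
      (f := S 0 4) ?_ ?_ ?_
    · linarith
    · linarith [hprod 0 1 1 2]
    · linarith [hprod 2 3 3 4]
  have hoddc : 0 ≤ S 1 3 ∧ 0 ≤ S 3 5 := by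
    have h13 := hsq 1 3
    have h35 := hsq 3 5
    have h15 := hsq 1 5
    simp [Fin.sum_univ_six, pathMatrix, hodd, hsym 1 3, hsym 3 5] at h13 h35 h15
    refine sqrt_jacobi_offDiag_nonneg (hdiag 1) (hdiag 5) (hmin 1 3) (hmin 3 5)
      (f := S 1 5) ?_ ?_ ?_
    · linarith
    · linarith [hprod 1 2 2 3]
    · linarith [hprod 3 4 4 5]
  refine ⟨S, hS, hSH, hSS, hodd, fun i j h1 h2 => ?_⟩
  by_cases h : (i.val + j.val) % 2 = 1
  · exact (hodd i j h).ge
  · have hcases : ∀ i j : Fin 6, i.val + 4 ≠ j.val → j.val + 4 ≠ i.val →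
        ¬(i.val + j.val) % 2 = 1 → i = j ∨ (i = 0 ∧ j = 2) ∨ (i = 2 ∧ j = 4) ∨
        (i = 1 ∧ j = 3) ∨ (i = 3 ∧ j = 5) ∨ (j = 0 ∧ i = 2) ∨ (j = 2 ∧ i = 4) ∨
        (j = 1 ∧ i = 3) ∨ (j = 3 ∧ i = 5) := by decide
    rcases hcases i j h1 h2 h with rfl | ⟨rfl, rfl⟩ | ⟨rfl, rfl⟩ | ⟨rfl, rfl⟩ | ⟨rfl, rfl⟩ |
      ⟨rfl, rfl⟩ | ⟨rfl, rfl⟩ | ⟨rfl, rfl⟩ | ⟨rfl, rfl⟩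
    · exact hdiag _
    · exact heven.1
    · exact heven.2
    · exact hoddc.1
    · exact hoddc.2
    · rw [hsym 0 2]; exact heven.1
    · rw [hsym 2 4]; exact heven.2
    · rw [hsym 1 3]; exact hoddc.1
    · rw [hsym 3 5]; exact hoddc.2

theorem exists_pathMatrix_certificate (r : Fin 6 → ℝ) (hr : ∀ i, 0 ≤ r i) :
    ∃ Y : Matrix (Fin 6) (Fin 6) ℝ, Y.PosSemidef ∧
      (∀ i j, i.val + 4 ≠ j.val → j.val + 4 ≠ i.val → 0 ≤ Y i j) ∧
      2 * ∑ i, ∑ j, pathMatrix r i j * Y i j - ∑ i, ∑ j, Y i j ^ 2 =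
        ∑ i : Fin 5, r i.castSucc ^ 2 * r i.succ ^ 2 := by
  obtain ⟨S, hS, hSH, hSS, hodd, hnonneg⟩ := exists_abs_pathMatrix r hr
  refine ⟨(1 / 2 : ℝ) • (S + pathMatrix r), hSH.smul (by norm_num), ?_, ?_⟩
  · intro i j h1 h2
    have hS0 := hnonneg i j h1 h2
    have hH0 : 0 ≤ pathMatrix r i j := by
      unfold pathMatrix
      split_ifs
      exacts [mul_nonneg (hr i) (hr j), le_rfl]
    simp only [Matrix.smul_apply, Matrix.add_apply, smul_eq_mul]
    positivity
  · have hcross : ∀ i j, pathMatrix r i j * S i j = 0 := by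
      intro i j
      by_cases h : (i.val + j.val) % 2 = 1
      · simp [hodd i j h]
      · have : pathMatrix r i j = 0 := by
          unfold pathMatrix
          rw [if_neg]
          omega
        simp [this]
    have htr : ∑ i, ∑ j, S i j ^ 2 = ∑ i, ∑ j, pathMatrix r i j ^ 2 := by
      refine Finset.sum_congr rfl fun i _ => ?_
      have hsym : ∀ j, S j i = S i j := fun j => by simpa using hS.1.apply i j
      have hsq := congrFun (congrFun hSS i) i
      simp only [Matrix.mul_apply] at hsq
      have hHs : ∀ k, pathMatrix r k i = pathMatrix r i k := fun k => by
        simpa using (isHermitian_pathMatrix r).apply i k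
      simpa only [hsym, hHs, ← sq] using hsq
    have hY : ∀ i j, (2 * (pathMatrix r i j * ((1 / 2 : ℝ) • (S + pathMatrix r)) i j) -
        ((1 / 2 : ℝ) • (S + pathMatrix r)) i j ^ 2) =
        3 / 4 * pathMatrix r i j ^ 2 - 1 / 4 * S i j ^ 2 := fun i j => by
      simp only [Matrix.smul_apply, Matrix.add_apply, smul_eq_mul]
      linear_combination (1 / 2) * hcross i j
    simp only [Finset.mul_sum]
    simp only [← Finset.sum_sub_distrib, hY]
    simp only [Finset.sum_sub_distrib, ← Finset.mul_sum, htr]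
    simp [Fin.sum_univ_six, Fin.sum_univ_five, pathMatrix]
    ring

theorem sum_sum_comp {V ι : Type*} [Fintype V] [Fintype ι] [DecidableEq ι] (π : V → ι)
    (F : ι → ι → ℝ) :
    ∑ a, ∑ b, F (π a) (π b) = ∑ i, ∑ j,
      ((Finset.univ.filter (π · = i)).card : ℝ) * (Finset.univ.filter (π · = j)).card * F i j := by
  have h : ∀ f : ι → ℝ, ∑ a, f (π a) = ∑ i, ((Finset.univ.filter (π · = i)).card : ℝ) * f i := by
    intro f
    rw [← Finset.sum_fiberwise Finset.univ π]
    refine Finset.sum_congr rfl fun i _ => ?_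
    rw [Finset.sum_congr rfl (g := fun _ => f i) fun a ha => by rw [(Finset.mem_filter.1 ha).2]]
    simp
  simp only [h]
  rw [h fun i => ∑ j, ((Finset.univ.filter (π · = j)).card : ℝ) * F i j]
  simp only [Finset.mul_sum, mul_assoc]

/-- Lower bound for graphs containing a blow-up of a path on six vertices, provided that no edge
joins classes at distance four. -/
theorem sum_card_mul_card_le_sPlus {V : Type*} [Fintype V] [DecidableEq V] (G : SimpleGraph V)
    [DecidableRel G.Adj] (π : V → Fin 6)
    (hadj : ∀ a b, (π a).val + 1 = (π b).val → G.Adj a b)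
    (hnon : ∀ a b, (π a).val + 4 = (π b).val → ¬G.Adj a b) :
    ∑ i : Fin 5, ((Finset.univ.filter (π · = i.castSucc)).card : ℝ) *
      (Finset.univ.filter (π · = i.succ)).card ≤ sPlus G := by
  set n : Fin 6 → ℝ := fun i => ((Finset.univ.filter (π · = i)).card : ℝ) with hn
  have hn0 : ∀ i, 0 ≤ n i := fun i => Nat.cast_nonneg _
  have hnπ : ∀ a, 0 < n (π a) := fun a => by
    simp only [hn, Nat.cast_pos, Finset.card_pos]
    exact ⟨a, by simp⟩
  set r : Fin 6 → ℝ := fun i => √(n i) with hr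
  have hr2 : ∀ i, r i ^ 2 = n i := fun i => Real.sq_sqrt (hn0 i)
  have hr0 : ∀ i, 0 ≤ r i := fun i => Real.sqrt_nonneg _
  have hrπ : ∀ a, 0 < r (π a) := fun a => Real.sqrt_pos.2 (hnπ a)
  obtain ⟨Y, hY, hYnonneg, hYval⟩ := exists_pathMatrix_certificate r hr0
  set D : Matrix V V ℝ := diagonal fun a => (r (π a))⁻¹ with hD
  have hX : (D * Y.submatrix π π * D).PosSemidef := by
    have := (hY.submatrix π).conjTranspose_mul_mul_same D
    rwa [hD, diagonal_conjTranspose, star_trivial] at this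
  have hXval : ∀ a b, (D * Y.submatrix π π * D) a b =
      (r (π a))⁻¹ * Y (π a) (π b) * (r (π b))⁻¹ := fun a b => by simp [hD]
  have h := two_mul_sum_sub_sum_sq_le_sPlus G hX
  simp only [hXval] at h
  have h1 : ∑ i, ∑ j, pathMatrix r i j * Y i j ≤
      ∑ a, ∑ b, G.adjMatrix ℝ a b * ((r (π a))⁻¹ * Y (π a) (π b) * (r (π b))⁻¹) := by
    have e := sum_sum_comp π fun i j =>
      if i.val + 1 = j.val ∨ j.val + 1 = i.val then (r i)⁻¹ * Y i j * (r j)⁻¹ else 0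
    refine le_of_eq_of_le (Eq.trans ?_ e.symm) ?_
    · refine Finset.sum_congr rfl fun i _ => Finset.sum_congr rfl fun j _ => ?_
      change _ = n i * n j * _
      simp only [pathMatrix]
      split_ifs
      · have hi : ∀ i, r i ^ 2 * (r i)⁻¹ = r i := fun i => by
          rcases (hr0 i).eq_or_lt with h0 | h0
          · simp [← h0]
          · field_simp
        rw [← hr2 i, ← hr2 j]
        linear_combination (-(Y i j) * r j ^ 2 * (r j)⁻¹) * hi i - Y i j * r i * hi j
      · ring
    · refine Finset.sum_le_sum fun a _ => Finset.sum_le_sum fun b _ => ?_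
      split_ifs with hab
      · have : G.Adj a b := hab.elim (hadj a b) fun hba => (hadj b a hba).symm
        simp [SimpleGraph.adjMatrix_apply, this]
      · by_cases h4 : (π a).val + 4 ≠ (π b).val ∧ (π b).val + 4 ≠ (π a).val
        · have := hYnonneg _ _ h4.1 h4.2
          have := hr0 (π a)
          have := hr0 (π b)
          have : 0 ≤ G.adjMatrix ℝ a b := by
            rw [SimpleGraph.adjMatrix_apply]; split_ifs <;> norm_num
          positivity
        · have : ¬G.Adj a b := by
            rw [not_and_or, not_not, not_not] at h4
            exact h4.elim (hnon a b) fun hba hadj' => hnon b a hba hadj'.symm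
          simp [SimpleGraph.adjMatrix_apply, this]
  have h2 : ∑ a, ∑ b, ((r (π a))⁻¹ * Y (π a) (π b) * (r (π b))⁻¹) ^ 2 ≤
      ∑ i, ∑ j, Y i j ^ 2 := by
    rw [sum_sum_comp π fun i j => ((r i)⁻¹ * Y i j * (r j)⁻¹) ^ 2]
    refine Finset.sum_le_sum fun i _ => Finset.sum_le_sum fun j _ => ?_
    change n i * n j * _ ≤ _
    have hi : ∀ i, n i * (r i)⁻¹ ^ 2 ≤ 1 := fun i => by
      rw [← hr2 i, ← mul_pow]
      exact pow_le_one₀ (mul_nonneg (hr0 i) (inv_nonneg.2 (hr0 i))) mul_inv_le_one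
    calc _ = (n i * (r i)⁻¹ ^ 2) * (n j * (r j)⁻¹ ^ 2) * Y i j ^ 2 := by ring
      _ ≤ 1 * Y i j ^ 2 := by
        refine mul_le_mul_of_nonneg_right ?_ (sq_nonneg _)
        exact mul_le_one₀ (hi i) (mul_nonneg (hn0 j) (sq_nonneg _)) (hi j)
      _ = _ := one_mul _
  simp only [hr2] at hYval
  change ∑ i : Fin 5, n i.castSucc * n i.succ ≤ _
  linarith

section Star

variable {V : Type*} [Fintype V] [DecidableEq V] (G : SimpleGraph V) [DecidableRel G.Adj]

/-- A positive multiple of the Perron vector of the star formed by `u` and its neighbours. -/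
noncomputable def starVec (u a : V) : ℝ :=
  (if a = u then √(G.degree u) else 0) + if G.Adj u a then 1 else 0

theorem starVec_nonneg (u a : V) : 0 ≤ starVec G u a := by
  unfold starVec
  have := Real.sqrt_nonneg (G.degree u : ℝ)
  split_ifs <;> linarith

theorem starVec_dotProduct_starVec {u v : V} (huv : ¬G.Adj u v) (hne : u ≠ v) :
    starVec G u ⬝ᵥ starVec G v = ((G.neighborFinset u ∩ G.neighborFinset v).card : ℝ) := by
  have h : ∀ a, starVec G u a * starVec G v a =
      if a ∈ G.neighborFinset u ∩ G.neighborFinset v then 1 else 0 := by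
    intro a
    have hvu : ¬G.Adj v u := fun h => huv h.symm
    simp only [starVec, Finset.mem_inter, SimpleGraph.mem_neighborFinset]
    by_cases h1 : a = u
    · subst h1; simp [hvu, hne]
    · by_cases h2 : a = v
      · subst h2; simp [huv, h1]
      · by_cases h3 : G.Adj u a <;> by_cases h4 : G.Adj v a <;> simp [h1, h2, h3, h4]
  simp only [dotProduct, h, Finset.sum_ite_mem, Finset.univ_inter]
  simp

theorem starVec_dotProduct_self (u : V) : starVec G u ⬝ᵥ starVec G u = 2 * G.degree u := by
  have h : ∀ a, starVec G u a * starVec G u a =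
      (if a = u then (G.degree u : ℝ) else 0) + if a ∈ G.neighborFinset u then 1 else 0 := by
    intro a
    simp only [starVec, SimpleGraph.mem_neighborFinset]
    by_cases h1 : a = u
    · subst h1; simp
    · by_cases h3 : G.Adj u a <;> simp [h1, h3]
  simp only [dotProduct, h, Finset.sum_add_distrib, Finset.sum_ite_mem, Finset.univ_inter]
  simp
  ring

theorem le_starVec_dotProduct_mulVec (u : V) :
    2 * √(G.degree u) * G.degree u ≤
      starVec G u ⬝ᵥ G.adjMatrix ℝ *ᵥ starVec G u := by
  have hA : ∀ a, (G.adjMatrix ℝ *ᵥ starVec G u) a = ∑ b ∈ G.neighborFinset a, starVec G u b :=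
    fun a => G.adjMatrix_mulVec_apply a _
  have hu : (G.degree u : ℝ) ≤ (G.adjMatrix ℝ *ᵥ starVec G u) u := by
    rw [hA, ← G.card_neighborFinset_eq_degree, Finset.card_eq_sum_ones, Nat.cast_sum]
    refine Finset.sum_le_sum fun b hb => ?_
    have hub : G.Adj u b := by simpa using hb
    simp [starVec, hub, hub.ne']
  have hN : ∀ a, G.Adj u a → √(G.degree u) ≤ (G.adjMatrix ℝ *ᵥ starVec G u) a := by
    intro a ha
    rw [hA]
    refine le_trans ?_ (Finset.single_le_sum (fun b _ => starVec_nonneg G u b)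
      ((G.mem_neighborFinset a u).2 ha.symm))
    simp [starVec]
  have h0 : ∀ a, 0 ≤ (G.adjMatrix ℝ *ᵥ starVec G u) a := fun a => by
    rw [hA]; exact Finset.sum_nonneg fun b _ => starVec_nonneg G u b
  have hle : ∀ a, (if a = u then √(G.degree u) * G.degree u else 0) +
      (if a ∈ G.neighborFinset u then √(G.degree u) else 0) ≤
      starVec G u a * (G.adjMatrix ℝ *ᵥ starVec G u) a := by
    intro a
    have hs := Real.sqrt_nonneg (G.degree u : ℝ)
    simp only [starVec, SimpleGraph.mem_neighborFinset]
    by_cases h1 : a = u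
    · subst h1; simpa using mul_le_mul_of_nonneg_left hu hs
    · by_cases h3 : G.Adj u a
      · simpa [h1, h3] using hN a h3
      · simp [h1, h3]
  refine le_trans (le_of_eq ?_) (Finset.sum_le_sum fun a _ => hle a)
  simp only [Finset.sum_add_distrib, Finset.sum_ite_mem, Finset.univ_inter]
  simp
  ring

/-- Lower bound coming from the stars at two nonadjacent vertices together with a further
vector. -/
theorem degree_add_degree_le_sPlus {u v : V} (huv : ¬G.Adj u v) (hne : u ≠ v)
    (hu : 0 < G.degree u) (hv : 0 < G.degree v) {t : ℝ} (ht : 0 ≤ t) (z : V → ℝ) :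
    (G.degree u : ℝ) + G.degree v -
        ((G.neighborFinset u ∩ G.neighborFinset v).card : ℝ) ^ 2 /
          (2 * √(G.degree u) * √(G.degree v)) +
        (2 * t * (z ⬝ᵥ G.adjMatrix ℝ *ᵥ z) - t ^ 2 * (z ⬝ᵥ z) ^ 2 -
          t * (starVec G u ⬝ᵥ z) ^ 2 / √(G.degree u) -
          t * (starVec G v ⬝ᵥ z) ^ 2 / √(G.degree v)) ≤ sPlus G := by
  have hk : (0 : ℝ) < √(G.degree u) := Real.sqrt_pos.2 (by exact_mod_cast hu)
  have hl : (0 : ℝ) < √(G.degree v) := Real.sqrt_pos.2 (by exact_mod_cast hv)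
  have h := sum_rankOne_le_sPlus G ![1 / (2 * √(G.degree u)), 1 / (2 * √(G.degree v)), t]
    (by intro i; fin_cases i <;> simp [ht]) ![starVec G u, starVec G v, z]
  simp only [Fin.sum_univ_three, Matrix.cons_val_zero, Matrix.cons_val_one, Matrix.cons_val] at h
  rw [dotProduct_comm z (starVec G u), dotProduct_comm z (starVec G v),
    dotProduct_comm (starVec G v) (starVec G u), starVec_dotProduct_starVec G huv hne,
    starVec_dotProduct_self, starVec_dotProduct_self] at h
  have h1 := le_starVec_dotProduct_mulVec G u
  have h2 := le_starVec_dotProduct_mulVec G v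
  have hk2 := Real.sq_sqrt (Nat.cast_nonneg (α := ℝ) (G.degree u))
  have hl2 := Real.sq_sqrt (Nat.cast_nonneg (α := ℝ) (G.degree v))
  generalize starVec G u ⬝ᵥ G.adjMatrix ℝ *ᵥ starVec G u = p at *
  generalize starVec G v ⬝ᵥ G.adjMatrix ℝ *ᵥ starVec G v = q at *
  generalize √(G.degree u : ℝ) = k at *
  generalize √(G.degree v : ℝ) = l at *
  rw [← hk2, ← hl2] at *
  have h1' : k ^ 2 ≤ 1 / (2 * k) * p := by
    rw [div_mul_eq_mul_div, le_div_iff₀ (by positivity)]; linarith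
  have h2' : l ^ 2 ≤ 1 / (2 * l) * q := by
    rw [div_mul_eq_mul_div, le_div_iff₀ (by positivity)]; linarith
  refine le_trans ?_ h
  rw [← sub_nonneg] at h1' h2' ⊢
  refine le_of_le_of_eq (add_nonneg (add_nonneg h1' h1') (add_nonneg h2' h2')) ?_
  field_simp
  ring

end Star

theorem exists_pair_of_dominationNumber_eq_two {V : Type*} [DecidableEq V] {G : SimpleGraph V}
    (h : dominationNumber G = 2) :
    ∃ u v : V, u ≠ v ∧ ∀ a, a ≠ u → a ≠ v → G.Adj u a ∨ G.Adj v a := by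
  have hne : {k : ℕ | ∃ S : Finset V, S.card = k ∧ IsDominatingSet G S}.Nonempty :=
    Nat.nonempty_of_pos_sInf (by unfold dominationNumber at h; omega)
  obtain ⟨S, hS, hdom⟩ := Nat.sInf_mem hne
  change S.card = dominationNumber G at hS
  obtain ⟨u, v, huv, rfl⟩ := Finset.card_eq_two.1 (hS.trans h)
  refine ⟨u, v, huv, fun a hau hav => ?_⟩
  obtain ⟨b, hb, hba⟩ := hdom a (by simp [hau, hav])
  rcases Finset.mem_insert.1 hb with rfl | hb
  · exact Or.inl hba
  · rw [Finset.mem_singleton] at hb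
    exact Or.inr (hb ▸ hba)

theorem card_eq_sum_fin_six {V : Type*} [Fintype V] (π : V → Fin 6) :
    (Fintype.card V : ℝ) = ∑ i, ((Finset.univ.filter (π · = i)).card : ℝ) := by
  rw [← Finset.card_univ, Finset.card_eq_sum_card_fiberwise (f := π) (t := Finset.univ)
    (fun _ _ => Finset.mem_univ _), Nat.cast_sum]

theorem card_fiber_eq_one {V ι : Type*} [Fintype V] [DecidableEq ι] {π : V → ι} {i : ι}
    {u : V} (h : ∀ a, π a = i ↔ a = u) : (Finset.univ.filter (π · = i)).card = 1 := by
  rw [Finset.card_eq_one]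
  exact ⟨u, by ext a; simp [h]⟩

theorem card_fiber_eq_zero {V ι : Type*} [Fintype V] [DecidableEq ι] {π : V → ι} {i : ι}
    (h : ∀ a, π a ≠ i) : (Finset.univ.filter (π · = i)).card = 0 := by
  simp [h]

section Domination

variable {V : Type*} [Fintype V] [DecidableEq V] {G : SimpleGraph V} [DecidableRel G.Adj]

theorem card_sub_one_le_sPlus_of_adj {u v : V}
    (hdom : ∀ a, a ≠ u → a ≠ v → G.Adj u a ∨ G.Adj v a) (huv : G.Adj u v) :
    (Fintype.card V : ℝ) - 1 ≤ sPlus G := by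
  set π : V → Fin 6 := fun a =>
    if a = u then 1 else if a = v then 2 else if G.Adj u a then 0 else 3 with hπ
  have h := sum_card_mul_card_le_sPlus G π
    (by
      intro a b
      have := hdom a
      have := hdom b
      simp only [hπ]
      split_ifs <;> simp <;> grind [SimpleGraph.adj_comm])
    (by
      intro a b
      simp only [hπ]
      split_ifs <;> simp)
  have hne := huv.ne
  have h1 := card_fiber_eq_one (π := π) (i := 1) (u := u) (fun a => by grind)
  have h2 := card_fiber_eq_one (π := π) (i := 2) (u := v) (fun a => by grind)
  have h4 := card_fiber_eq_zero (π := π) (i := 4) (fun a => by grind)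
  have h5 := card_fiber_eq_zero (π := π) (i := 5) (fun a => by grind)
  rw [card_eq_sum_fin_six π]
  simp [Fin.sum_univ_five, Fin.sum_univ_six, h1, h2, h4, h5] at h ⊢
  linarith

theorem card_sub_one_le_sPlus_of_common_neighbor {u v w : V}
    (hdom : ∀ a, a ≠ u → a ≠ v → G.Adj u a ∨ G.Adj v a) (hne : u ≠ v)
    (huw : G.Adj u w) (hvw : G.Adj v w) (huniq : ∀ a, G.Adj u a → G.Adj v a → a = w)
    (hcross : ∀ a b, G.Adj u a → ¬G.Adj v a → G.Adj v b → ¬G.Adj u b → ¬G.Adj a b) :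
    (Fintype.card V : ℝ) - 1 ≤ sPlus G := by
  have hwu := huw.ne'
  have hwv := hvw.ne'
  set π : V → Fin 6 := fun a =>
    if a = u then 1 else if a = w then 2 else if a = v then 3 else if G.Adj u a then 0 else 4
    with hπ
  have h := sum_card_mul_card_le_sPlus G π
    (by
      intro a b
      have := hdom a
      have := hdom b
      simp only [hπ]
      split_ifs <;> simp <;> grind [SimpleGraph.adj_comm])
    (by
      intro a b
      have := hdom a
      have := hdom b
      have := huniq a
      have := hcross a b
      simp only [hπ]
      split_ifs <;> simp <;> grind [SimpleGraph.adj_comm])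
  have h1 := card_fiber_eq_one (π := π) (i := 1) (u := u) (fun a => by grind)
  have h2 := card_fiber_eq_one (π := π) (i := 2) (u := w) (fun a => by grind)
  have h3 := card_fiber_eq_one (π := π) (i := 3) (u := v) (fun a => by grind)
  have h5 := card_fiber_eq_zero (π := π) (i := 5) (fun a => by grind)
  rw [card_eq_sum_fin_six π]
  simp [Fin.sum_univ_five, Fin.sum_univ_six, h1, h2, h3, h5] at h ⊢
  linarith

theorem card_sub_one_le_sPlus_of_path {u v x y : V}
    (hdom : ∀ a, a ≠ u → a ≠ v → G.Adj u a ∨ G.Adj v a) (hne : u ≠ v) (huv : ¬G.Adj u v)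
    (hdisj : ∀ a, G.Adj u a → ¬G.Adj v a) (hux : G.Adj u x) (hvy : G.Adj v y)
    (hxy : G.Adj x y) : (Fintype.card V : ℝ) - 1 ≤ sPlus G := by
  have hxu := hux.ne'
  have hyv := hvy.ne'
  have hxv : x ≠ v := by rintro rfl; exact huv hux
  have hyu : y ≠ u := by rintro rfl; exact huv hvy.symm
  have hyx := hxy.ne'
  set π : V → Fin 6 := fun a =>
    if a = u then 1 else if a = x then 2 else if a = y then 3 else if a = v then 4 else
      if G.Adj u a then 0 else 5 with hπ
  have h := sum_card_mul_card_le_sPlus G π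
    (by
      intro a b
      have := hdom a
      have := hdom b
      simp only [hπ]
      split_ifs <;> simp <;> grind [SimpleGraph.adj_comm])
    (by
      intro a b
      have := hdisj a
      simp only [hπ]
      split_ifs <;> simp <;> grind [SimpleGraph.adj_comm])
  have h1 := card_fiber_eq_one (π := π) (i := 1) (u := u) (fun a => by grind)
  have h2 := card_fiber_eq_one (π := π) (i := 2) (u := x) (fun a => by grind)
  have h3 := card_fiber_eq_one (π := π) (i := 3) (u := y) (fun a => by grind)
  have h4 := card_fiber_eq_one (π := π) (i := 4) (u := v) (fun a => by grind)
  rw [card_eq_sum_fin_six π]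
  simp [Fin.sum_univ_five, Fin.sum_univ_six, h1, h2, h3, h4] at h ⊢
  linarith

theorem card_eq_degree_add_degree {u v : V}
    (hdom : ∀ a, a ≠ u → a ≠ v → G.Adj u a ∨ G.Adj v a) (hne : u ≠ v) (huv : ¬G.Adj u v) :
    (Fintype.card V : ℝ) + ((G.neighborFinset u ∩ G.neighborFinset v).card : ℝ) =
      G.degree u + G.degree v + 2 := by
  have h1 := Finset.card_union_add_card_inter (G.neighborFinset u) (G.neighborFinset v)
  have h2 : Finset.univ = {u, v} ∪ (G.neighborFinset u ∪ G.neighborFinset v) := by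
    ext a
    have := hdom a
    simp only [Finset.mem_univ, Finset.mem_union, Finset.mem_insert, Finset.mem_singleton,
      SimpleGraph.mem_neighborFinset, true_iff]
    tauto
  have h3 : Disjoint {u, v} (G.neighborFinset u ∪ G.neighborFinset v) := by
    have hvu : ¬G.Adj v u := fun h => huv h.symm
    simp [huv, hvu]
  have h4 : Fintype.card V = 2 + (G.neighborFinset u ∪ G.neighborFinset v).card := by
    rw [← Finset.card_univ, h2, Finset.card_union_of_disjoint h3, Finset.card_pair hne]
  simp only [SimpleGraph.card_neighborFinset_eq_degree] at h1
  have : Fintype.card V + (G.neighborFinset u ∩ G.neighborFinset v).card =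
      G.degree u + G.degree v + 2 := by omega
  exact_mod_cast this

theorem card_sub_one_le_sPlus_of_two_le {u v : V}
    (hdom : ∀ a, a ≠ u → a ≠ v → G.Adj u a ∨ G.Adj v a) (hne : u ≠ v) (huv : ¬G.Adj u v)
    (hc : 2 ≤ (G.neighborFinset u ∩ G.neighborFinset v).card) :
    (Fintype.card V : ℝ) - 1 ≤ sPlus G := by
  have hcu := Finset.card_le_card
    (Finset.inter_subset_left (s₁ := G.neighborFinset u) (s₂ := G.neighborFinset v))
  have hcv := Finset.card_le_card
    (Finset.inter_subset_right (s₁ := G.neighborFinset u) (s₂ := G.neighborFinset v))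
  rw [SimpleGraph.card_neighborFinset_eq_degree] at hcu hcv
  have hcard := card_eq_degree_add_degree hdom hne huv
  have h := degree_add_degree_le_sPlus G huv hne (by omega) (by omega) le_rfl 0
  set c := (G.neighborFinset u ∩ G.neighborFinset v).card
  have hc' : (2 : ℝ) ≤ c := by exact_mod_cast hc
  have hq : (c : ℝ) ^ 2 / (2 * √(G.degree u) * √(G.degree v)) ≤ c / 2 := by
    have h1 : √(c : ℝ) ≤ √(G.degree u) := Real.sqrt_le_sqrt (by exact_mod_cast hcu)
    have h2 : √(c : ℝ) ≤ √(G.degree v) := Real.sqrt_le_sqrt (by exact_mod_cast hcv)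
    have h3 : (c : ℝ) ≤ √(G.degree u) * √(G.degree v) := by
      rw [← Real.mul_self_sqrt (Nat.cast_nonneg (α := ℝ) c)]
      exact mul_le_mul h1 h2 (Real.sqrt_nonneg _) (Real.sqrt_nonneg _)
    rw [mul_assoc, div_le_iff₀ (by linarith)]
    nlinarith
  simp at h
  linarith

theorem card_sub_one_le_sPlus_of_pentagon {u v x y : V}
    (hdom : ∀ a, a ≠ u → a ≠ v → G.Adj u a ∨ G.Adj v a) (hne : u ≠ v) (huv : ¬G.Adj u v)
    (hc : (G.neighborFinset u ∩ G.neighborFinset v).card = 1) (hux : G.Adj u x)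
    (hvx : ¬G.Adj v x) (hvy : G.Adj v y) (huy : ¬G.Adj u y) (hxy : G.Adj x y) :
    (Fintype.card V : ℝ) - 1 ≤ sPlus G := by
  obtain ⟨w, hw⟩ := Finset.card_pos.1 (hc ▸ Nat.one_pos)
  simp only [Finset.mem_inter, SimpleGraph.mem_neighborFinset] at hw
  have hxv : x ≠ v := by rintro rfl; exact huv hux
  have hyu : y ≠ u := by rintro rfl; exact huv hvy.symm
  have hdu : 2 ≤ G.degree u := by
    rw [← Finset.card_pair (show x ≠ w by rintro rfl; exact hvx hw.2),
      ← G.card_neighborFinset_eq_degree]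
    exact Finset.card_le_card (by simp [Finset.insert_subset_iff, hux, hw.1])
  have hdv : 2 ≤ G.degree v := by
    rw [← Finset.card_pair (show y ≠ w by rintro rfl; exact huy hw.1),
      ← G.card_neighborFinset_eq_degree]
    exact Finset.card_le_card (by simp [Finset.insert_subset_iff, hvy, hw.2])
  have hcard := card_eq_degree_add_degree hdom hne huv
  set z : V → ℝ := Pi.single x 1 + Pi.single y 1 with hz
  have hzu : starVec G u ⬝ᵥ z = 1 := by
    simp [hz, dotProduct_add, starVec, hux, huy, hux.ne', hyu]
  have hzv : starVec G v ⬝ᵥ z = 1 := by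
    simp [hz, dotProduct_add, starVec, hvx, hvy, hvy.ne', hxv]
  have hzz : z ⬝ᵥ z = 2 := by
    simp [hz, dotProduct_add, hxy.ne, hxy.ne']
    norm_num
  have hzA : z ⬝ᵥ G.adjMatrix ℝ *ᵥ z = 2 := by
    simp [hz, mulVec_add, add_dotProduct, hxy, hxy.symm, dotProduct_add]
    norm_num
  have h := degree_add_degree_le_sPlus G huv hne (by omega) (by omega)
    (by norm_num : (0 : ℝ) ≤ 1 / 4) z
  rw [hzu, hzv, hzz, hzA, hc] at h
  rw [hc] at hcard
  have hs : ∀ k : ℕ, 2 ≤ k → (√(k : ℝ))⁻¹ ≤ 5 / 7 ∧ 0 ≤ (√(k : ℝ))⁻¹ := fun k hk => by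
    have hk' : (2 : ℝ) ≤ k := by exact_mod_cast hk
    have h75 : (7 / 5 : ℝ) ≤ √(k : ℝ) := Real.le_sqrt_of_sq_le (by norm_num; linarith)
    refine ⟨?_, by positivity⟩
    rw [inv_le_comm₀ (by linarith) (by norm_num)]
    norm_num
    exact h75
  obtain ⟨hu1, hu0⟩ := hs _ hdu
  obtain ⟨hv1, hv0⟩ := hs _ hdv
  simp only [div_eq_mul_inv, mul_inv] at h
  have hprod : (√(G.degree u : ℝ))⁻¹ * (√(G.degree v : ℝ))⁻¹ ≤ 5 / 7 * (5 / 7) :=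
    mul_le_mul hu1 hv1 hv0 (by norm_num)
  push_cast at h hcard
  nlinarith

end Domination

/-- A connected graph of order `n` with domination number `2` satisfies `s⁺(G) ≥ n - 1`. -/
theorem stmt_3 {V : Type*} [Fintype V] [DecidableEq V] (G : SimpleGraph V) [DecidableRel G.Adj]
    (hconn : G.Connected) (hdom : dominationNumber G = 2) :
    (Fintype.card V : ℝ) - 1 ≤ sPlus G := by
  obtain ⟨u, v, hne, hdom⟩ := exists_pair_of_dominationNumber_eq_two hdom
  by_cases huv : G.Adj u v
  · exact card_sub_one_le_sPlus_of_adj hdom huv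
  by_cases hc2 : 2 ≤ (G.neighborFinset u ∩ G.neighborFinset v).card
  · exact card_sub_one_le_sPlus_of_two_le hdom hne huv hc2
  by_cases hc1 : (G.neighborFinset u ∩ G.neighborFinset v).card = 1
  · by_cases hcross : ∃ x y, G.Adj u x ∧ ¬G.Adj v x ∧ G.Adj v y ∧ ¬G.Adj u y ∧ G.Adj x y
    · obtain ⟨x, y, hux, hvx, hvy, huy, hxy⟩ := hcross
      exact card_sub_one_le_sPlus_of_pentagon hdom hne huv hc1 hux hvx hvy huy hxy
    · obtain ⟨w, hw⟩ := Finset.card_eq_one.1 hc1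
      have hw' : ∀ a, G.Adj u a ∧ G.Adj v a ↔ a = w := fun a => by
        simpa using Finset.ext_iff.1 hw a
      obtain ⟨huw, hvw⟩ := (hw' w).2 rfl
      exact card_sub_one_le_sPlus_of_common_neighbor hdom hne huw hvw
        (fun a hua hva => (hw' a).1 ⟨hua, hva⟩)
        fun a b hua hva hvb hub hab => hcross ⟨a, b, hua, hva, hvb, hub, hab⟩
  · have hdisj : ∀ a, G.Adj u a → ¬G.Adj v a := fun a hua hva => by
      have : 0 < (G.neighborFinset u ∩ G.neighborFinset v).card :=
        Finset.card_pos.2 ⟨a, by simp [hua, hva]⟩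
      omega
    obtain ⟨p⟩ := hconn.preconnected u v
    obtain ⟨d, -, hd1, hd2⟩ := p.exists_boundary_dart {a | a = u ∨ G.Adj u a} (Or.inl rfl)
      (by simp [hne.symm, huv])
    simp only [Set.mem_ofPred_eq, not_or] at hd1 hd2
    have hux : G.Adj u d.fst := hd1.resolve_left fun h => hd2.2 (h ▸ d.adj)
    have hyv : d.snd ≠ v := fun h => hdisj _ hux (h ▸ d.adj.symm)
    have hvy : G.Adj v d.snd := (hdom _ hd2.1 hyv).resolve_left hd2.2
    exact card_sub_one_le_sPlus_of_path hdom hne huv hdisj hux hvy d.adj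

end SquareEnergy
end

section
/- Let G be a simple graph and let U be a set of three vertices of G such that the induced subgraph G[U] is isomorphic to the path P_3 on three vertices. Then there exists a vertex u ∈ U such that s⁺(G) ≥ s⁺(G − u) + 1 + 1/16, where G − u denotes the induced subgraph obtained by deleting u. -/
open Matrix

namespace SquareEnergy

section Frobenius

variable {n : Type*} [Fintype n]

theorem trace_transpose_mul_self (M : Matrix n n ℝ) :
    (Mᵀ * M).trace = ∑ i, ∑ j, M i j ^ 2 := by
  rw [Finset.sum_comm]
  simp [Matrix.trace, Matrix.mul_apply, sq]

variable [DecidableEq n]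

theorem sum_sq_conj_of_orthogonal {Q : Matrix n n ℝ} (hQ : Q * Qᵀ = 1) (M : Matrix n n ℝ) :
    ∑ i, ∑ j, (Qᵀ * M * Q) i j ^ 2 = ∑ i, ∑ j, M i j ^ 2 := by
  rw [← trace_transpose_mul_self, ← trace_transpose_mul_self]
  have h : (Qᵀ * M * Q)ᵀ * (Qᵀ * M * Q) = Qᵀ * (Mᵀ * M * Q) := by
    calc (Qᵀ * M * Q)ᵀ * (Qᵀ * M * Q) = Qᵀ * (Mᵀ * (Q * Qᵀ) * M * Q) := by
          simp only [Matrix.transpose_mul, Matrix.transpose_transpose, Matrix.mul_assoc]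
      _ = _ := by rw [hQ, Matrix.mul_one]
  rw [h, Matrix.trace_mul_comm, Matrix.mul_assoc, hQ, Matrix.mul_one]

theorem exists_orthogonal_diagonalization {A : Matrix n n ℝ} (hA : A.IsHermitian) :
    ∃ Q : Matrix n n ℝ, Q * Qᵀ = 1 ∧ Qᵀ * Q = 1 ∧
      Qᵀ * A * Q = diagonal hA.eigenvalues := by
  refine ⟨hA.eigenvectorUnitary, ?_, ?_, ?_⟩
  · simpa [Matrix.star_eq_conjTranspose] using Unitary.coe_mul_star_self hA.eigenvectorUnitary
  · simpa [Matrix.star_eq_conjTranspose] using Unitary.coe_star_mul_self hA.eigenvectorUnitary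
  · have h := hA.conjStarAlgAut_star_eigenvectorUnitary
    rw [Unitary.conjStarAlgAut_star_apply] at h
    simpa [Matrix.star_eq_conjTranspose, Function.comp_def] using h

/-- Adding a positive semidefinite matrix to `A` cannot push the squared Frobenius norm below the
sum of the squares of the positive eigenvalues of `A`. -/
theorem sum_sq_pos_eigenvalues_le {A N : Matrix n n ℝ} (hA : A.IsHermitian)
    (hN : N.PosSemidef) :
    (∑ i, if 0 < hA.eigenvalues i then hA.eigenvalues i ^ 2 else 0) ≤
      ∑ i, ∑ j, (A + N) i j ^ 2 := by
  obtain ⟨Q, hQ, -, hD⟩ := exists_orthogonal_diagonalization hA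
  rw [← sum_sq_conj_of_orthogonal hQ (A + N)]
  have hN' : (Qᵀ * N * Q).PosSemidef := by simpa using hN.conjTranspose_mul_mul_same Q
  refine Finset.sum_le_sum fun i _ => ?_
  refine le_trans ?_ (Finset.single_le_sum (f := fun j => (Qᵀ * (A + N) * Q) i j ^ 2)
    (fun j _ => sq_nonneg _) (Finset.mem_univ i))
  have hi : (Qᵀ * (A + N) * Q) i i = hA.eigenvalues i + (Qᵀ * N * Q) i i := by
    rw [Matrix.mul_add, Matrix.add_mul, hD, Matrix.add_apply, Matrix.diagonal_apply_eq]
  have h0 : 0 ≤ (Qᵀ * N * Q) i i := hN'.diag_nonneg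
  simp only [hi]
  split_ifs with h
  · gcongr
    linarith
  · positivity

/-- The bound of `sum_sq_pos_eigenvalues_le` is attained, by the negative part of `A`. -/
theorem exists_posSemidef_sum_sq_eq {A : Matrix n n ℝ} (hA : A.IsHermitian) :
    ∃ N : Matrix n n ℝ, N.PosSemidef ∧ ∑ i, ∑ j, (A + N) i j ^ 2 =
      ∑ i, if 0 < hA.eigenvalues i then hA.eigenvalues i ^ 2 else 0 := by
  obtain ⟨Q, hQ, hQ', hD⟩ := exists_orthogonal_diagonalization hA
  refine ⟨Q * diagonal (fun i => max (-hA.eigenvalues i) 0) * Qᵀ, ?_, ?_⟩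
  · simpa using (Matrix.PosSemidef.diagonal (R := ℝ)
      (d := fun i => max (-hA.eigenvalues i) 0)
      (fun i => le_max_right _ _)).mul_mul_conjTranspose_same Q
  · have h : Qᵀ * (A + Q * diagonal (fun i => max (-hA.eigenvalues i) 0) * Qᵀ) * Q =
        diagonal (fun i => hA.eigenvalues i + max (-hA.eigenvalues i) 0) := by
      rw [Matrix.mul_add, Matrix.add_mul, hD, ← Matrix.diagonal_add]
      congr 1
      calc _ = (Qᵀ * Q) * diagonal (fun i => max (-hA.eigenvalues i) 0) * (Qᵀ * Q) := by
            simp only [Matrix.mul_assoc]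
        _ = _ := by rw [hQ', Matrix.mul_one, Matrix.one_mul]
    rw [← sum_sq_conj_of_orthogonal hQ, h]
    refine Finset.sum_congr rfl fun i _ => ?_
    rw [Finset.sum_eq_single i (fun j _ hj => by simp [Matrix.diagonal_apply_ne' _ hj])
      (by simp), Matrix.diagonal_apply_eq]
    split_ifs with hi
    · rw [max_eq_right (by linarith), add_zero]
    · rw [max_eq_left (by linarith)]
      ring

end Frobenius

theorem sum_sq_submatrix_ne_add_le {V : Type*} [Fintype V] [DecidableEq V] {M : Matrix V V ℝ}
    (hM : M.IsSymm) {u v w : V} (hv : v ≠ u) (hw : w ≠ u) (hvw : v ≠ w) :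
    (∑ i : {x // x ≠ u}, ∑ j : {x // x ≠ u}, M i j ^ 2) +
      (M u u ^ 2 + 2 * (M u v ^ 2 + M u w ^ 2)) ≤ ∑ i, ∑ j, M i j ^ 2 := by
  have hrow : M u v ^ 2 + M u w ^ 2 ≤ ∑ j : {x // x ≠ u}, M u j ^ 2 := by
    have hne : (⟨v, hv⟩ : {x // x ≠ u}) ≠ ⟨w, hw⟩ := by simpa using hvw
    rw [← Finset.sum_pair (f := fun j : {x // x ≠ u} => M u j ^ 2) hne]
    exact Finset.sum_le_sum_of_subset_of_nonneg (Finset.subset_univ _)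
      fun _ _ _ => sq_nonneg _
  rw [Fintype.sum_eq_add_sum_subtype_ne _ u, Fintype.sum_eq_add_sum_subtype_ne _ u]
  simp_rw [fun i : {x // x ≠ u} => Fintype.sum_eq_add_sum_subtype_ne (fun j => M i j ^ 2) u,
    Finset.sum_add_distrib, fun i : {x // x ≠ u} => hM.apply u i]
  linarith

/-- The numerical core: `h` is the quadratic form of the matrix with diagonal `α, β, γ` and
off-diagonal entries `x - 1, y - 1, z` evaluated at `(1, 7/4, 1)`; if it is nonnegative, then one of
the three row weights is at least `17/16`. -/
theorem path_weight_bound {α β γ x y z : ℝ}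
    (h : 0 ≤ α + γ + 2 * z + 49 / 16 * β + 7 / 2 * (x - 1) + 7 / 2 * (y - 1))
    (ha : α ^ 2 + 2 * (x ^ 2 + z ^ 2) < 17 / 16) (hb : β ^ 2 + 2 * (x ^ 2 + y ^ 2) < 17 / 16)
    (hc : γ ^ 2 + 2 * (z ^ 2 + y ^ 2) < 17 / 16) : False := by
  nlinarith [sq_nonneg (α - 3 / 4), sq_nonneg (γ - 3 / 4), sq_nonneg (z - 3 / 8),
    sq_nonneg (β - 49 / 64), sq_nonneg (x - 1 / 3), sq_nonneg (y - 1 / 3)]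

theorem sPlus_induce_add_le {V : Type*} [Fintype V] [DecidableEq V] (G : SimpleGraph V)
    [DecidableRel G.Adj] {N : Matrix V V ℝ} (hN : N.PosSemidef)
    (hG : ∑ i, ∑ j, (G.adjMatrix ℝ + N) i j ^ 2 = sPlus G) {u v w : V}
    (hv : v ≠ u) (hw : w ≠ u) (hvw : v ≠ w) :
    sPlus (G.induce {x : V | x ≠ u}) + ((G.adjMatrix ℝ + N) u u ^ 2 +
      2 * ((G.adjMatrix ℝ + N) u v ^ 2 + (G.adjMatrix ℝ + N) u w ^ 2)) ≤ sPlus G := by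
  have hsymm : (G.adjMatrix ℝ + N).IsSymm :=
    G.isSymm_adjMatrix.add (by simpa [Matrix.IsHermitian, Matrix.IsSymm] using hN.1)
  rw [← hG]
  refine le_trans (add_le_add_left ?_ _) (sum_sq_submatrix_ne_add_le hsymm hv hw hvw)
  let := Classical.decRel (G.induce {x : V | x ≠ u}).Adj
  refine (sum_sq_pos_eigenvalues_le (adj_isHermitian (G.induce {x : V | x ≠ u}))
    (hN.submatrix Subtype.val)).trans (le_of_eq ?_)
  refine Finset.sum_congr rfl fun i _ => Finset.sum_congr rfl fun j _ => ?_
  simp [SimpleGraph.adjMatrix_apply]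

theorem exists_adj_of_induce_iso_pathGraph_three {V : Type*} {G : SimpleGraph V} {U : Set V}
    (e : G.induce U ≃g SimpleGraph.pathGraph 3) :
    ∃ a ∈ U, ∃ b ∈ U, ∃ c ∈ U, a ≠ c ∧ G.Adj a b ∧ G.Adj b c ∧ ¬ G.Adj a c := by
  have hadj (i j : Fin 3) :
      G.Adj (e.symm i) (e.symm j) ↔ (SimpleGraph.pathGraph 3).Adj i j := by
    simpa using e.symm.map_adj_iff (v := i) (w := j)
  refine ⟨e.symm 0, (e.symm 0).2, e.symm 1, (e.symm 1).2, e.symm 2, (e.symm 2).2, ?_, ?_, ?_, ?_⟩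
  · simp [Subtype.val_inj]
  all_goals
    rw [hadj, SimpleGraph.pathGraph_adj]
    decide

/-- The `P₃`-removal lemma for `s⁺`: if `U` is a set of three vertices inducing a path `P₃`,
then some `u ∈ U` satisfies `s⁺(G) ≥ s⁺(G - u) + 1 + 1/16`. -/
theorem stmt_4 {V : Type*} [Fintype V] [DecidableEq V] (G : SimpleGraph V) [DecidableRel G.Adj]
    (U : Finset V) (hU3 : U.card = 3)
    (hP3 : Nonempty ((G.induce (U : Set V)) ≃g SimpleGraph.pathGraph 3)) :
    ∃ u ∈ U, sPlus (G.induce {v : V | v ≠ u}) + 1 + 1 / 16 ≤ sPlus G := by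
  obtain ⟨e⟩ := hP3
  obtain ⟨a, ha, b, hb, c, hc, hac, hab, hbc, hnac⟩ := exists_adj_of_induce_iso_pathGraph_three e
  obtain ⟨N, hN, hG⟩ := exists_posSemidef_sum_sq_eq
    (@adj_isHermitian V _ _ G (Classical.decRel G.Adj))
  have hG' : ∑ i, ∑ j, (G.adjMatrix ℝ + N) i j ^ 2 = sPlus G := by
    rw [sPlus, adjEig, ← hG]
    congr!
  have hba : N b a = N a b := by simpa using hN.1.apply a b
  have hcb : N c b = N b c := by simpa using hN.1.apply b c
  have hca : N c a = N a c := by simpa using hN.1.apply a c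
  have hquad := (hN.submatrix ![a, b, c]).dotProduct_mulVec_nonneg ![1, 7 / 4, 1]
  simp [Matrix.mulVec, dotProduct, Fin.sum_univ_three, hba, hcb, hca] at hquad
  have h₁ := sPlus_induce_add_le G hN hG' hab.ne' hac.symm hbc.ne
  have h₂ := sPlus_induce_add_le G hN hG' hab.ne hbc.ne' hac
  have h₃ := sPlus_induce_add_le G hN hG' hac hbc.ne hab.ne
  simp [SimpleGraph.adjMatrix_apply, hab, hbc, hnac, hab.symm, hbc.symm, G.adj_comm c a,
    hba, hcb, hca] at h₁ h₂ h₃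
  by_contra! hcon
  have h₁' := hcon a ha
  have h₂' := hcon b hb
  have h₃' := hcon c hc
  refine path_weight_bound (α := N a a) (β := N b b) (γ := N c c) (x := 1 + N a b)
    (y := 1 + N b c) (z := N a c) ?_ ?_ ?_ ?_ <;> linarith

end SquareEnergy
end

section
/- Let A be a real symmetric n×n matrix and write A = A⁺ − A⁻ for its spectral decomposition into positive and negative parts, i.e., A⁺ and A⁻ are positive semidefinite with A⁺A⁻ = 0 and A = A⁺ − A⁻. Then for every positive semidefinite n×n real matrix M, tr((A + M)²) ≥ tr((A⁺)²) + tr((A⁻ − M)²). -/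
open Matrix

namespace SquareEnergy

/-- The trace of a product of two real positive semidefinite matrices is nonnegative. -/
theorem trace_mul_nonneg_of_posSemidef {ι : Type*} [Fintype ι]
    {P Q : Matrix ι ι ℝ} (hP : P.PosSemidef) (hQ : Q.PosSemidef) : 0 ≤ (P * Q).trace := by
  classical
  obtain ⟨B, rfl⟩ : ∃ B : Matrix ι ι ℝ, P = Bᴴ * B := by
    open scoped MatrixOrder in
    exact CStarAlgebra.nonneg_iff_eq_star_mul_self.mp hP.nonneg
  rw [Matrix.mul_assoc, Matrix.trace_mul_comm]
  exact (hQ.mul_mul_conjTranspose_same B).trace_nonneg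

/-- For a real symmetric matrix `A` with spectral decomposition `A = A⁺ − A⁻` into positive and
negative parts, and any positive semidefinite `M`,
`tr((A + M)²) ≥ tr((A⁺)²) + tr((A⁻ − M)²)`. -/
theorem stmt_6 {n : ℕ} (A Ap Am M : Matrix (Fin n) (Fin n) ℝ)
    (hA : A.IsSymm) (hAp : Ap.PosSemidef) (hAm : Am.PosSemidef)
    (hmul : Ap * Am = 0) (hdecomp : A = Ap - Am) (hM : M.PosSemidef) :
    (Ap ^ 2).trace + ((Am - M) ^ 2).trace ≤ ((A + M) ^ 2).trace := by
  have hApM := trace_mul_nonneg_of_posSemidef hAp hM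
  have hexp : (A + M) ^ 2 =
      Ap ^ 2 + (Am - M) ^ 2 - Ap * Am - Am * Ap + Ap * M + M * Ap := by
    rw [hdecomp]
    noncomm_ring
  rw [hexp]
  simp only [Matrix.trace_add, Matrix.trace_sub, Matrix.trace_mul_comm Am Ap,
    Matrix.trace_mul_comm M Ap, hmul, Matrix.trace_zero]
  linarith

end SquareEnergy
end

section
/- For all non-negative integers j, k, ℓ, the graph P(j,k,ℓ) obtained from a triangle by attaching paths of lengths j, k and ℓ at its three distinct vertices satisfies s⁺(P(j,k,ℓ)) ≥ j + k + ℓ + 3, i.e., s⁺ is at least the order of the graph. -/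
open Matrix

namespace SquareEnergy

/-- Underlying relation for `P(j,k,ℓ)`: a triangle on `Fin 3`, with a pendant path of `j`
extra vertices attached at triangle vertex `0`, a pendant path of `k` extra vertices attached at
triangle vertex `1`, and a pendant path of `ℓ` extra vertices attached at triangle vertex `2`. -/
def trianglePathsRel (j k l : ℕ) :
    (Fin 3 ⊕ (Fin j ⊕ Fin k ⊕ Fin l)) → (Fin 3 ⊕ (Fin j ⊕ Fin k ⊕ Fin l)) → Prop
  | Sum.inl _, Sum.inl _ => True
  | Sum.inl x, Sum.inr (Sum.inl p) => x = 0 ∧ p.val = 0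
  | Sum.inl x, Sum.inr (Sum.inr (Sum.inl q)) => x = 1 ∧ q.val = 0
  | Sum.inl x, Sum.inr (Sum.inr (Sum.inr r)) => x = 2 ∧ r.val = 0
  | Sum.inr (Sum.inl p), Sum.inr (Sum.inl p') => p'.val = p.val + 1
  | Sum.inr (Sum.inr (Sum.inl q)), Sum.inr (Sum.inr (Sum.inl q')) => q'.val = q.val + 1
  | Sum.inr (Sum.inr (Sum.inr r)), Sum.inr (Sum.inr (Sum.inr r')) => r'.val = r.val + 1
  | _, _ => False

/-- The graph `P(j,k,ℓ)`: a triangle with pendant paths of `j`, `k` and `ℓ` additional vertices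
attached at its three distinct vertices.  It has `3 + j + k + ℓ` vertices. -/
def trianglePaths (j k l : ℕ) : SimpleGraph (Fin 3 ⊕ (Fin j ⊕ Fin k ⊕ Fin l)) :=
  SimpleGraph.fromRel (trianglePathsRel j k l)

theorem arctan_le_self {x : ℝ} (hx : 0 ≤ x) : Real.arctan x ≤ x := by
  simpa using Real.le_tan (Real.arctan_nonneg.2 hx) (Real.arctan_lt_pi_div_two x)

theorem div_one_add_sq_le_arctan {x : ℝ} (hx : 0 ≤ x) : x / (1 + x ^ 2) ≤ Real.arctan x := by
  have h := Real.sin_le (Real.arctan_nonneg.2 hx)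
  refine le_trans ?_ h
  rw [Real.sin_arctan]
  refine div_le_div_of_nonneg_left hx (by positivity) ?_
  exact Real.sqrt_le_iff.2 ⟨by positivity, by nlinarith [sq_nonneg x, sq_nonneg (x ^ 2)]⟩

/-- A primitive of `t ↦ t * arctan (a / t) - a / 2` on the positive reals. -/
noncomputable def arctanPrimitive (a t : ℝ) : ℝ := (t ^ 2 + a ^ 2) / 2 * Real.arctan (a / t)

theorem hasDerivAt_arctanPrimitive (a : ℝ) {t : ℝ} (ht : 0 < t) :
    HasDerivAt (arctanPrimitive a) (t * Real.arctan (a / t) - a / 2) t := by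
  have h1 : HasDerivAt (fun t : ℝ => a / t) (-a / t ^ 2) t := by
    simpa [div_eq_mul_inv] using (hasDerivAt_inv ht.ne').const_mul a
  have h2 : HasDerivAt (fun t : ℝ => (t ^ 2 + a ^ 2) / 2) t t := by
    simpa using ((hasDerivAt_pow 2 t).add_const (a ^ 2)).div_const 2
  refine (h2.mul h1.arctan).congr_deriv ?_
  have : t ^ 2 + a ^ 2 ≠ 0 := by positivity
  field_simp
  ring

theorem le_arctanPrimitive (a : ℝ) {t : ℝ} (ht : 0 < t) :
    a * t / 2 - |a| ^ 3 / (2 * t) ≤ arctanPrimitive a t := by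
  unfold arctanPrimitive
  have hp : 0 < t ^ 2 + a ^ 2 := by positivity
  rcases le_or_gt 0 a with ha | ha
  · have h := mul_le_mul_of_nonneg_left (div_one_add_sq_le_arctan (div_nonneg ha ht.le))
      (half_pos hp).le
    have e : (t ^ 2 + a ^ 2) / 2 * (a / t / (1 + (a / t) ^ 2)) = a * t / 2 := by
      field_simp
    have : 0 ≤ |a| ^ 3 / (2 * t) := by positivity
    linarith
  · have h := mul_le_mul_of_nonneg_left (arctan_le_self (div_nonneg (neg_nonneg.2 ha.le) ht.le))
      (half_pos hp).le
    rw [neg_div, Real.arctan_neg] at h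
    have e : (t ^ 2 + a ^ 2) / 2 * -(a / t) = - (a * t / 2 - |a| ^ 3 / (2 * t)) := by
      rw [abs_of_neg ha]
      field_simp
      ring
    linarith

open Filter Topology in
theorem tendsto_arctanPrimitive (a : ℝ) :
    Tendsto (arctanPrimitive a) (𝓝[>] 0) (𝓝 (Real.pi / 4 * (a * |a|))) := by
  have h1 : Tendsto (fun t : ℝ => (t ^ 2 + a ^ 2) / 2) (𝓝[>] 0) (𝓝 (a ^ 2 / 2)) := by
    have : ContinuousAt (fun t : ℝ => (t ^ 2 + a ^ 2) / 2) 0 := by fun_prop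
    simpa using this.tendsto.mono_left nhdsWithin_le_nhds
  rcases lt_trichotomy a 0 with ha | rfl | ha
  · have h2 : Tendsto (fun t : ℝ => Real.arctan (a / t)) (𝓝[>] 0) (𝓝 (-(Real.pi / 2))) :=
      (Real.tendsto_arctan_atBot.mono_right nhdsWithin_le_nhds).comp
        (tendsto_inv_nhdsGT_zero.const_mul_atTop_of_neg ha)
    have e : Real.pi / 4 * (a * |a|) = a ^ 2 / 2 * -(Real.pi / 2) := by rw [abs_of_neg ha]; ring
    exact e ▸ h1.mul h2
  · have : arctanPrimitive 0 = fun _ => 0 := by ext t; simp [arctanPrimitive]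
    simp [this]
  · have h2 : Tendsto (fun t : ℝ => Real.arctan (a / t)) (𝓝[>] 0) (𝓝 (Real.pi / 2)) :=
      (Real.tendsto_arctan_atTop.mono_right nhdsWithin_le_nhds).comp
        (tendsto_inv_nhdsGT_zero.const_mul_atTop ha)
    have e : Real.pi / 4 * (a * |a|) = a ^ 2 / 2 * (Real.pi / 2) := by rw [abs_of_pos ha]; ring
    exact e ▸ h1.mul h2

theorem add_I_mul_eq_norm_mul_exp (a : ℝ) {t : ℝ} (ht : 0 < t) :
    (t : ℂ) + Complex.I * a =
      (‖(t : ℂ) + Complex.I * a‖ : ℝ) * Complex.exp (Real.arctan (a / t) * Complex.I) := by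
  have h : Real.arctan (a / t) = Complex.arg (t + Complex.I * a) := by
    have h := Complex.tan_arg (t + Complex.I * a)
    simp only [Complex.add_re, Complex.ofReal_re, Complex.I_mul_re, Complex.ofReal_im, neg_zero,
      add_zero, Complex.add_im, Complex.I_mul_im, zero_add] at h
    refine Real.arctan_eq_of_tan_eq h ?_
    have := Complex.abs_arg_lt_pi_div_two_iff (z := t + Complex.I * a)
    exact abs_lt.1 (this.2 (Or.inl (by simpa using ht)))
  rw [h]
  exact (Complex.norm_mul_exp_arg_mul_I _).symm

theorem prod_add_I_mul_im {ι : Type*} [Fintype ι] (a : ι → ℝ) {t : ℝ} (ht : 0 < t) :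
    (∏ i, ((t : ℂ) + Complex.I * a i)).im =
      (∏ i, ‖(t : ℂ) + Complex.I * a i‖) * Real.sin (∑ i, Real.arctan (a i / t)) := by
  rw [Finset.prod_congr rfl fun i _ => add_I_mul_eq_norm_mul_exp (a i) ht, Finset.prod_mul_distrib,
    ← Complex.exp_sum, ← Finset.sum_mul, ← Complex.ofReal_prod, ← Complex.ofReal_sum,
    Complex.im_ofReal_mul, Complex.exp_ofReal_mul_I_im]

open Filter Topology in
theorem sum_arctan_div_neg {ι : Type*} [Fintype ι] (a : ι → ℝ)
    (h : ∀ t : ℝ, 0 < t → (∏ i, ((t : ℂ) + Complex.I * a i)).im < 0) {t : ℝ} (ht : 0 < t) :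
    ∑ i, Real.arctan (a i / t) < 0 := by
  set Θ : ℝ → ℝ := fun t => ∑ i, Real.arctan (a i / t) with hΘ
  have hsin : ∀ t, 0 < t → Real.sin (Θ t) < 0 := fun t ht => by
    have h := h t ht
    rw [prod_add_I_mul_im a ht] at h
    exact neg_of_mul_neg_right h (Finset.prod_nonneg fun _ _ => norm_nonneg _)
  have hlim : Tendsto Θ atTop (𝓝 0) := by
    have : ∀ i, Tendsto (fun t : ℝ => Real.arctan (a i / t)) atTop (𝓝 0) := fun i => by
      simpa [Function.comp_def] using
        (Real.continuous_arctan.tendsto 0).comp (tendsto_id.const_div_atTop (a i))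
    simpa using tendsto_finsetSum Finset.univ fun i _ => this i
  by_contra! h0
  obtain ⟨T, hT, htT⟩ :=
    ((hlim.eventually_lt_const Real.pi_pos).and (eventually_ge_atTop t)).exists
  have hTneg : Θ T < 0 := by
    by_contra! h1
    exact (hsin T (ht.trans_le htT)).not_ge (Real.sin_nonneg_of_nonneg_of_le_pi h1 hT.le)
  have hcont : ContinuousOn Θ (Set.Icc t T) := by
    refine continuousOn_finsetSum _ fun i _ => Real.continuous_arctan.comp_continuousOn ?_
    exact continuousOn_const.div continuousOn_id fun s hs => (ht.trans_le hs.1).ne'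
  obtain ⟨s, hs, hs0⟩ := intermediate_value_Icc' htT hcont ⟨hTneg.le, h0⟩
  simpa [hs0] using hsin s (ht.trans_le hs.1)

open Filter Topology in
theorem sum_mul_abs_nonneg {ι : Type*} [Fintype ι] (a : ι → ℝ) (ha : ∑ i, a i = 0)
    (h : ∀ t : ℝ, 0 < t → (∏ i, ((t : ℂ) + Complex.I * a i)).im < 0) :
    0 ≤ ∑ i, a i * |a i| := by
  set H : ℝ → ℝ := fun t => ∑ i, arctanPrimitive (a i) t with hH
  have hder : ∀ t, 0 < t → HasDerivAt H (t * ∑ i, Real.arctan (a i / t)) t := fun t ht => by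
    refine (HasDerivAt.fun_sum (u := Finset.univ)
      fun i _ => hasDerivAt_arctanPrimitive (a i) ht).congr_deriv ?_
    rw [Finset.sum_sub_distrib, ← Finset.sum_div, ha, Finset.mul_sum]
    simp
  have hanti : AntitoneOn H (Set.Ioi 0) := by
    refine antitoneOn_of_deriv_nonpos (convex_Ioi 0)
      (fun t ht => (hder t ht).continuousAt.continuousWithinAt)
      (fun t ht => (hder t (interior_subset ht)).differentiableAt.differentiableWithinAt)
      fun t ht => ?_
    have ht := interior_subset ht
    rw [(hder t ht).deriv]
    exact mul_nonpos_of_nonneg_of_nonpos (le_of_lt ht) (sum_arctan_div_neg a h ht).le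
  have hbound : ∀ t, 0 < t → -H t ≤ (∑ i, |a i| ^ 3 / 2) / t := fun t ht => by
    have h1 := Finset.sum_le_sum fun i (_ : i ∈ Finset.univ) => le_arctanPrimitive (a i) ht
    have h2 : ∑ i, a i * t / 2 = 0 := by rw [← Finset.sum_div, ← Finset.sum_mul, ha]; simp
    rw [Finset.sum_sub_distrib, h2, zero_sub] at h1
    rw [Finset.sum_div]
    simp only [div_div]
    exact neg_le.1 h1
  have hnonneg : ∀ s, 0 < s → 0 ≤ H s := fun s hs => by
    refine neg_nonpos.1 (ge_of_tendsto (tendsto_id.const_div_atTop (∑ i, |a i| ^ 3 / 2)) ?_)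
    filter_upwards [eventually_ge_atTop s] with t hst
    exact (neg_le_neg (hanti hs (hs.trans_le hst) hst)).trans (hbound t (hs.trans_le hst))
  have hlim : Tendsto H (𝓝[>] 0) (𝓝 (∑ i, Real.pi / 4 * (a i * |a i|))) :=
    tendsto_finsetSum _ fun i _ => tendsto_arctanPrimitive (a i)
  rw [← Finset.mul_sum] at hlim
  have := ge_of_tendsto hlim (eventually_mem_nhdsWithin.mono hnonneg)
  exact nonneg_of_mul_nonneg_right this (by positivity)

theorem det_smul_one_add_smul_map {V : Type*} [Fintype V] [DecidableEq V] {A : Matrix V V ℝ}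
    (hA : A.IsHermitian) (x y : ℂ) :
    (x • (1 : Matrix V V ℂ) + y • A.map Complex.ofReal).det = ∏ i, (x + y * hA.eigenvalues i) := by
  rcases eq_or_ne y 0 with rfl | hy
  · simp
  have h1 : x • (1 : Matrix V V ℂ) + y • A.map Complex.ofReal =
      (-y) • (scalar V (-x / y) - A.map Complex.ofReal) := by
    ext i j
    simp only [Matrix.add_apply, Matrix.smul_apply, Matrix.sub_apply, smul_eq_mul, scalar_apply,
      Matrix.one_apply, Matrix.diagonal_apply]
    split_ifs <;> field_simp <;> ring
  have h2 : (A.map Complex.ofReal).charpoly =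
      ∏ i, (Polynomial.X - Polynomial.C (hA.eigenvalues i : ℂ)) := by
    have := A.charpoly_map Complex.ofRealHom
    rw [hA.charpoly_eq] at this
    refine this.trans ?_
    simp [Polynomial.map_prod]
  rw [h1, det_smul, ← eval_charpoly, h2, Polynomial.eval_prod, Fintype.card,
    ← Finset.prod_const, ← Finset.prod_mul_distrib]
  refine Finset.prod_congr rfl fun i _ => ?_
  simp only [Polynomial.eval_sub, Polynomial.eval_X, Polynomial.eval_C]
  field_simp
  ring

theorem inv_apply_of_conj_diagonal {W : Type*} [Fintype W] [DecidableEq W] {D D' : Matrix W W ℂ}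
    {e : W → ℂ} (he : ∀ w, e w * e w = 1) (h : ∀ u v, D' u v = e u * D u v * e v) (u v : W) :
    D'⁻¹ u v = e u * D⁻¹ u v * e v := by
  have hinv : (diagonal e)⁻¹ = diagonal e :=
    inv_eq_right_inv (by rw [diagonal_mul_diagonal]; simp [he])
  have hD : D' = diagonal e * D * diagonal e := by
    ext u v
    simp [h, mul_diagonal, diagonal_mul]
  rw [hD, Matrix.mul_inv_rev, Matrix.mul_inv_rev, hinv, ← mul_assoc]
  simp [mul_diagonal, diagonal_mul]

theorem det_smul_one_add_smul_map_re_pos {W : Type*} [Fintype W] [DecidableEq W]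
    {B : Matrix W W ℝ} (hB : B.IsHermitian) {s : W → ℝ} (hs : ∀ w, s w * s w = 1)
    (hsB : ∀ u v, s u * B u v * s v = -B u v) {t : ℝ} (ht : 0 < t) :
    ∃ d : ℝ, 0 < d ∧
      ((t : ℂ) • (1 : Matrix W W ℂ) + Complex.I • B.map Complex.ofReal).det = d := by
  set f : ℝ → ℂ := fun y => ∏ i, ((t : ℂ) + Complex.I * y * hB.eigenvalues i) with hf
  have hdet : ∀ y : ℝ, ((t : ℂ) • (1 : Matrix W W ℂ) +
      (Complex.I * y) • B.map Complex.ofReal).det = f y := fun y =>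
    det_smul_one_add_smul_map hB t (Complex.I * y)
  have hne : ∀ y, f y ≠ 0 := fun y => Finset.prod_ne_zero_iff.2 fun i _ h => by
    have := congrArg Complex.re h
    simp [mul_assoc] at this
    exact ht.ne' this
  have hreal : ∀ y, (f y).im = 0 := fun y => by
    rw [← Complex.conj_eq_iff_im, ← hdet, RingHom.map_det]
    have hS : (diagonal fun w => (s w : ℂ)) * diagonal (fun w => (s w : ℂ)) = 1 := by
      rw [diagonal_mul_diagonal]
      simp [← Complex.ofReal_mul, hs]
    rw [← det_conj_of_mul_eq_one hS hS]
    congr 1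
    ext u v
    have h2 := congrArg Complex.ofReal (hsB u v)
    push_cast at h2
    have h3 := congrArg Complex.ofReal (hs u)
    push_cast at h3
    rcases eq_or_ne u v with rfl | huv
    · simp [mul_diagonal, diagonal_mul]
      linear_combination (t : ℂ) * h3 - Complex.I * y * h2
    · simp [mul_diagonal, diagonal_mul, huv]
      linear_combination - Complex.I * y * h2
  have hcont : Continuous fun y => (f y).re := by
    refine Complex.continuous_re.comp (continuous_finsetProd _ fun i _ => ?_)
    fun_prop
  have h0 : 0 < (f 0).re := by
    have : f 0 = ((t ^ Fintype.card W : ℝ) : ℂ) := by simp [hf]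
    rw [this, Complex.ofReal_re]
    positivity
  refine ⟨(f 1).re, ?_, ?_⟩
  · by_contra! h1
    obtain ⟨y, hy⟩ := mem_range_of_exists_le_of_exists_ge hcont ⟨1, h1⟩ ⟨0, h0.le⟩
    exact hne y (Complex.ext hy (hreal y))
  · rw [Complex.ext (z := ((f 1).re : ℂ)) (w := f 1) (by simp) (by simp [hreal]), ← hdet]
    simp

theorem det_im_neg_of_triangle {W : Type*} [Fintype W] [DecidableEq W]
    {A : Matrix (Fin 3 ⊕ W) (Fin 3 ⊕ W) ℝ} (hA : A.IsHermitian)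
    (hA₁ : ∀ x y, A (Sum.inl x) (Sum.inl y) = if x = y then 0 else 1)
    {s : W → ℝ} (hs : ∀ w, s w * s w = 1)
    (hsA : ∀ u v, s u * A (Sum.inr u) (Sum.inr v) * s v = -A (Sum.inr u) (Sum.inr v))
    (hsA₁ : ∀ x w, A (Sum.inl x) (Sum.inr w) * s w = A (Sum.inl x) (Sum.inr w))
    {c : W → Fin 3} (hc : ∀ u v, A (Sum.inr u) (Sum.inr v) ≠ 0 → c u = c v)
    (hc₁ : ∀ x w, A (Sum.inl x) (Sum.inr w) ≠ 0 → c w = x) {t : ℝ} (ht : 0 < t) :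
    ((t : ℂ) • (1 : Matrix (Fin 3 ⊕ W) (Fin 3 ⊕ W) ℂ) +
      Complex.I • A.map Complex.ofReal).det.im < 0 := by
  have hsymm : ∀ u v, A u v = A v u := fun u v => by simpa using hA.apply v u
  have hB : A.toBlocks₂₂.IsHermitian := by
    ext u v
    exact hsymm (Sum.inr v) (Sum.inr u)
  obtain ⟨d, hd, hdet⟩ := det_smul_one_add_smul_map_re_pos hB hs hsA ht
  set D : Matrix W W ℂ := (t : ℂ) • (1 : Matrix W W ℂ) +
    Complex.I • A.toBlocks₂₂.map Complex.ofReal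
    with hD
  have hunit : IsUnit D.det := by
    rw [hdet]
    exact (Complex.ofReal_ne_zero.2 hd.ne').isUnit
  let := D.invertibleOfIsUnitDet hunit
  set C : Matrix (Fin 3) W ℂ := A.toBlocks₁₂.map Complex.ofReal with hC
  set E : Matrix (Fin 3) (Fin 3) ℂ := C * D⁻¹ * Cᵀ with hE
  have hEapply : ∀ x y, E x y = ∑ v, ∑ u, C x u * D⁻¹ u v * C y v := fun x y => by
    simp only [hE, Matrix.mul_apply, Finset.sum_mul, transpose_apply]
  have hinv_star : ∀ u v, (starRingEnd ℂ) (D⁻¹ v u) = s u * D⁻¹ u v * s v := fun u v => by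
    have := inv_apply_of_conj_diagonal (D := D) (D' := Dᴴ) (e := fun w => (s w : ℂ))
      (fun w => by exact_mod_cast hs w) (fun u v => ?_) u v
    · rw [← this, ← conjTranspose_nonsing_inv]
      rfl
    · have h2 := congrArg Complex.ofReal (hsA u v)
      have h3 := congrArg Complex.ofReal (hs u)
      push_cast at h2 h3
      rcases eq_or_ne u v with rfl | huv
      · simp [hD, toBlocks₂₂]
        linear_combination -(t : ℂ) * h3 - Complex.I * h2
      · simp [hD, toBlocks₂₂, huv, huv.symm, hsymm (Sum.inr v) (Sum.inr u)]
        linear_combination - Complex.I * h2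
  have hinv_zero : ∀ u v, c u ≠ c v → D⁻¹ u v = 0 := fun u v huv => by
    have := inv_apply_of_conj_diagonal (D := D) (D' := D)
      (e := fun w => if c w = c u then -1 else 1)
      (fun w => by split_ifs <;> simp) (fun w z => ?_) u v
    · simp [huv.symm] at this
      exact self_eq_neg.1 this
    · by_cases hwz : c w = c z
      · rw [hwz]
        split_ifs <;> simp
      · have h1 : w ≠ z := fun h => hwz (h ▸ rfl)
        have h2 : A (Sum.inr w) (Sum.inr z) = 0 := by
          by_contra h
          exact hwz (hc w z h)
        simp [hD, toBlocks₂₂, h1, h2]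
  have hE_zero : ∀ x y, x ≠ y → E x y = 0 := fun x y hxy => by
    rw [hEapply]
    refine Finset.sum_eq_zero fun v _ => Finset.sum_eq_zero fun u _ => ?_
    by_contra h
    have hx : A (Sum.inl x) (Sum.inr u) ≠ 0 := fun h' => h (by simp [hC, toBlocks₁₂, h'])
    have hy : A (Sum.inl y) (Sum.inr v) ≠ 0 := fun h' => h (by simp [hC, toBlocks₁₂, h'])
    refine h ?_
    rw [hinv_zero u v (by rwa [hc₁ x u hx, hc₁ y v hy])]
    simp
  have hE_real : ∀ x, ∃ r : ℝ, E x x = r := fun x => by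
    refine (Complex.conj_eq_iff_real).1 ?_
    rw [hEapply, map_sum, Finset.sum_comm]
    simp only [map_sum]
    refine Finset.sum_congr rfl fun v _ => Finset.sum_congr rfl fun u _ => ?_
    have hu := congrArg Complex.ofReal (hsA₁ x u)
    have hv := congrArg Complex.ofReal (hsA₁ x v)
    push_cast at hu hv
    rw [map_mul, map_mul, hinv_star]
    simp only [hC, toBlocks₁₂, map_apply, of_apply, Complex.conj_ofReal]
    linear_combination (A (Sum.inl x) (Sum.inr v) * s v * D⁻¹ v u : ℂ) * hu +
      (A (Sum.inl x) (Sum.inr u) * D⁻¹ v u : ℂ) * hv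
  have hblocks : (t : ℂ) • (1 : Matrix (Fin 3 ⊕ W) (Fin 3 ⊕ W) ℂ) +
      Complex.I • A.map Complex.ofReal
      = fromBlocks ((t : ℂ) • 1 + Complex.I • A.toBlocks₁₁.map Complex.ofReal) (Complex.I • C)
        (Complex.I • Cᵀ) D := by
    ext (x | u) (y | v)
    · simp [toBlocks₁₁, Matrix.one_apply]
    · simp [hC, toBlocks₁₂]
    · simp [hC, toBlocks₁₂, hsymm (Sum.inr u) (Sum.inl y)]
    · simp [hD, toBlocks₂₂, Matrix.one_apply]
  have hschur : (t : ℂ) • (1 : Matrix (Fin 3) (Fin 3) ℂ) +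
      Complex.I • A.toBlocks₁₁.map Complex.ofReal
      - (Complex.I • C) * ⅟D * (Complex.I • Cᵀ) =
      (t : ℂ) • 1 + Complex.I • A.toBlocks₁₁.map Complex.ofReal + E := by
    rw [invOf_eq_nonsing_inv, Matrix.smul_mul, Matrix.smul_mul, Matrix.mul_smul, smul_smul,
      Complex.I_mul_I, neg_one_smul, sub_neg_eq_add]
  obtain ⟨r₀, h₀⟩ := hE_real 0
  obtain ⟨r₁, h₁⟩ := hE_real 1
  obtain ⟨r₂, h₂⟩ := hE_real 2
  rw [hblocks, det_fromBlocks₂₂, hschur, hdet, Complex.im_ofReal_mul, det_fin_three]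
  refine mul_neg_of_pos_of_neg hd ?_
  simp [toBlocks₁₁, hA₁, h₀, h₁, h₂, hE_zero]

/-- The label of the triangle vertex carrying the pendant path of a vertex. -/
def pathLabel (j k l : ℕ) : Fin j ⊕ Fin k ⊕ Fin l → Fin 3 :=
  Sum.elim (fun _ => 0) (Sum.elim (fun _ => 1) fun _ => 2)

/-- The distance from a vertex of a pendant path to the first vertex of that path. -/
def pathIndex (j k l : ℕ) : Fin j ⊕ Fin k ⊕ Fin l → ℕ :=
  Sum.elim Fin.val (Sum.elim Fin.val Fin.val)

/-- The next vertex towards the triangle; on the triangle, the next vertex in cyclic order. -/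
def towardsTriangle (j k l : ℕ) :
    Fin 3 ⊕ (Fin j ⊕ Fin k ⊕ Fin l) → Fin 3 ⊕ (Fin j ⊕ Fin k ⊕ Fin l)
  | Sum.inl x => Sum.inl (x + 1)
  | Sum.inr (Sum.inl p) => if p.val = 0 then Sum.inl 0 else
      Sum.inr (Sum.inl ⟨p.val - 1, by omega⟩)
  | Sum.inr (Sum.inr (Sum.inl p)) => if p.val = 0 then Sum.inl 1 else
      Sum.inr (Sum.inr (Sum.inl ⟨p.val - 1, by omega⟩))
  | Sum.inr (Sum.inr (Sum.inr p)) => if p.val = 0 then Sum.inl 2 else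
      Sum.inr (Sum.inr (Sum.inr ⟨p.val - 1, by omega⟩))

section

variable {j k l : ℕ}

theorem adj_inl_inl {x y : Fin 3} :
    (trianglePaths j k l).Adj (Sum.inl x) (Sum.inl y) ↔ x ≠ y := by
  simp [trianglePaths, trianglePathsRel]

theorem adj_inl_inr {x : Fin 3} {w : Fin j ⊕ Fin k ⊕ Fin l} :
    (trianglePaths j k l).Adj (Sum.inl x) (Sum.inr w) ↔
      pathLabel j k l w = x ∧ pathIndex j k l w = 0 := by
  rcases w with p | p | p <;>
    simp [trianglePaths, trianglePathsRel, pathLabel, pathIndex, eq_comm]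

theorem adj_inr_inr {u v : Fin j ⊕ Fin k ⊕ Fin l} :
    (trianglePaths j k l).Adj (Sum.inr u) (Sum.inr v) ↔
      pathLabel j k l u = pathLabel j k l v ∧ (pathIndex j k l v = pathIndex j k l u + 1 ∨
        pathIndex j k l u = pathIndex j k l v + 1) := by
  rcases u with p | p | p <;> rcases v with q | q | q <;>
    simp [trianglePaths, trianglePathsRel, pathLabel, pathIndex] <;> grind

theorem adj_towardsTriangle (v : Fin 3 ⊕ (Fin j ⊕ Fin k ⊕ Fin l)) :
    (trianglePaths j k l).Adj v (towardsTriangle j k l v) := by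
  rcases v with x | p | p | p
  · rw [towardsTriangle, adj_inl_inl]
    fin_cases x <;> decide
  all_goals
    rw [towardsTriangle]
    split_ifs with h
    · rw [SimpleGraph.adj_comm, adj_inl_inr]
      exact ⟨rfl, h⟩
    · rw [adj_inr_inr]
      refine ⟨rfl, Or.inr ?_⟩
      simp only [pathIndex, Sum.elim_inl, Sum.elim_inr]
      omega

theorem towardsTriangle_towardsTriangle_ne (v : Fin 3 ⊕ (Fin j ⊕ Fin k ⊕ Fin l)) :
    towardsTriangle j k l (towardsTriangle j k l v) ≠ v := by
  rcases v with x | p | p | p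
  · simp only [towardsTriangle, ne_eq, Sum.inl.injEq]
    fin_cases x <;> decide
  all_goals
    rw [towardsTriangle]
    split_ifs with h
    · simp [towardsTriangle]
    · simp only [towardsTriangle]
      split_ifs
      · simp
      · simp only [ne_eq, Sum.inr.injEq, Sum.inl.injEq, Fin.ext_iff]
        omega

theorem le_sum_adjMatrix [DecidableRel (trianglePaths j k l).Adj] :
    2 * ((j : ℝ) + k + l + 3) ≤ ∑ u, ∑ v, (trianglePaths j k l).adjMatrix ℝ u v := by
  have h : ∀ u v, ((if v = towardsTriangle j k l u then 1 else 0) +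
      (if u = towardsTriangle j k l v then 1 else 0) : ℝ) ≤
      (trianglePaths j k l).adjMatrix ℝ u v := fun u v => by
    rw [SimpleGraph.adjMatrix_apply]
    by_cases h1 : v = towardsTriangle j k l u
    · have h2 : u ≠ towardsTriangle j k l v := by
        rw [h1]
        exact (towardsTriangle_towardsTriangle_ne u).symm
      have h3 : (trianglePaths j k l).Adj u v := h1 ▸ adj_towardsTriangle u
      rw [if_pos h1, if_neg h2, if_pos h3, add_zero]
    · rw [if_neg h1, zero_add]
      by_cases h2 : u = towardsTriangle j k l v
      · have h3 : (trianglePaths j k l).Adj u v :=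
          SimpleGraph.Adj.symm (h2 ▸ adj_towardsTriangle v)
        rw [if_pos h2, if_pos h3]
      · rw [if_neg h2]
        split_ifs <;> norm_num
  refine le_trans (le_of_eq ?_) (Finset.sum_le_sum fun u _ => Finset.sum_le_sum fun v _ => h u v)
  simp only [Finset.sum_add_distrib]
  rw [Finset.sum_comm (f := fun u v => if u = towardsTriangle j k l v then (1 : ℝ) else 0)]
  simp
  ring

end

theorem sum_eigenvalues_sq {V : Type*} [Fintype V] [DecidableEq V] {A : Matrix V V ℝ}
    (hA : A.IsHermitian) : ∑ i, hA.eigenvalues i ^ 2 = (A * A).trace := by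
  have h := hA.spectral_theorem
  have h2 : A * A = Unitary.conjStarAlgAut ℝ _ hA.eigenvectorUnitary
      (diagonal (RCLike.ofReal ∘ hA.eigenvalues) * diagonal (RCLike.ofReal ∘ hA.eigenvalues)) := by
    rw [map_mul, ← h]
  rw [h2, Unitary.conjStarAlgAut_apply, trace_mul_comm, ← mul_assoc]
  simp [diagonal_mul_diagonal, trace_diagonal, sq]

/-- `s⁺(P(j,k,ℓ)) ≥ j + k + ℓ + 3`, the order of the graph. -/
theorem stmt_8 (j k l : ℕ) :
    (j : ℝ) + k + l + 3 ≤ sPlus (trianglePaths j k l) := by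
  classical
  let := Classical.decRel (trianglePaths j k l).Adj
  set A := (trianglePaths j k l).adjMatrix ℝ with hAdef
  have hA : A.IsHermitian := adj_isHermitian _
  have heig : adjEig (trianglePaths j k l) = hA.eigenvalues := rfl
  have htrace : ∑ i, hA.eigenvalues i = 0 :=
    hA.trace_eq_sum_eigenvalues.symm.trans (SimpleGraph.trace_adjMatrix ℝ _)
  have hA₂ : ∀ u v, A (Sum.inr u) (Sum.inr v) ≠ 0 → pathLabel j k l u = pathLabel j k l v ∧
      (pathIndex j k l v = pathIndex j k l u + 1 ∨ pathIndex j k l u = pathIndex j k l v + 1) :=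
    fun u v h => by
      rw [← adj_inr_inr]
      by_contra h'
      exact h (by simp [hAdef, h'])
  have hA₁ : ∀ x w, A (Sum.inl x) (Sum.inr w) ≠ 0 →
      pathLabel j k l w = x ∧ pathIndex j k l w = 0 := fun x w h => by
    rw [← adj_inl_inr]
    by_contra h'
    exact h (by simp [hAdef, h'])
  have hdiff : 0 ≤ ∑ i, hA.eigenvalues i * |hA.eigenvalues i| := by
    refine sum_mul_abs_nonneg _ htrace fun t ht => ?_
    have hdet := det_smul_one_add_smul_map hA t Complex.I
    rw [← hdet]
    refine det_im_neg_of_triangle hA (fun x y => ?_) (s := fun w => (-1) ^ pathIndex j k l w)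
      (fun w => ?_) (fun u v => ?_) (fun x w => ?_) (fun u v h => (hA₂ u v h).1)
      (fun x w h => (hA₁ x w h).1) ht
    · rw [hAdef, SimpleGraph.adjMatrix_apply]
      simp only [adj_inl_inl]
      split_ifs <;> simp_all
    · rw [← mul_pow]
      simp
    · by_cases h : A (Sum.inr u) (Sum.inr v) = 0
      · simp [h]
      · have hsq : ∀ n, ((-1 : ℝ) ^ n) * (-1) ^ n = 1 := fun n => by rw [← mul_pow]; simp
        rcases (hA₂ u v h).2 with h' | h' <;> rw [h', pow_succ]
        · linear_combination (-A (Sum.inr u) (Sum.inr v)) * hsq (pathIndex j k l u)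
        · linear_combination (-A (Sum.inr u) (Sum.inr v)) * hsq (pathIndex j k l v)
    · by_cases h : A (Sum.inl x) (Sum.inr w) = 0
      · simp [h]
      · simp [(hA₁ x w h).2]
  have hsq : 2 * ((j : ℝ) + k + l + 3) ≤ ∑ i, hA.eigenvalues i ^ 2 := by
    rw [sum_eigenvalues_sq]
    refine le_sum_adjMatrix.trans (le_of_eq ?_)
    refine Finset.sum_congr rfl fun u _ => ?_
    rw [diag_apply, Matrix.mul_apply]
    refine Finset.sum_congr rfl fun v _ => ?_
    simp only [hAdef, SimpleGraph.adjMatrix_apply, SimpleGraph.adj_comm _ v u]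
    split_ifs <;> simp
  have hsplit : 2 * sPlus (trianglePaths j k l) =
      ∑ i, hA.eigenvalues i ^ 2 + ∑ i, hA.eigenvalues i * |hA.eigenvalues i| := by
    rw [sPlus, heig, ← Finset.sum_add_distrib, Finset.mul_sum]
    refine Finset.sum_congr rfl fun i _ => ?_
    split_ifs with h
    · rw [abs_of_pos h]
      ring
    · rw [abs_of_nonpos (not_lt.1 h)]
      ring
  linarith

end SquareEnergy
end

section
/- For every non-negative integer j, the graph P(j,0,0) obtained from a triangle by attaching a path of length j at one of its vertices satisfies s⁺(P(j,0,0)) ≥ j + 3. -/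
open Matrix

namespace SquareEnergy

theorem two_mul_trace_sub_le_sum_eigenvalues {n : Type*} [Fintype n] [DecidableEq n]
    {A X : Matrix n n ℝ} (hA : A.IsHermitian) (hX : X.PosSemidef) :
    2 * (A * X).trace - (X * X).trace ≤
      ∑ i, if 0 < hA.eigenvalues i then hA.eigenvalues i ^ 2 else 0 := by
  set U : Matrix n n ℝ := (hA.eigenvectorUnitary : Matrix n n ℝ)
  have hUU : U * Uᴴ = 1 := Unitary.coe_mul_star_self hA.eigenvectorUnitary
  have hspec : A = U * diagonal hA.eigenvalues * Uᴴ := by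
    conv_lhs => rw [hA.spectral_theorem, Unitary.conjStarAlgAut_apply]
    rfl
  set Y := Uᴴ * X * U with hY
  have hYpsd : Y.PosSemidef := hX.conjTranspose_mul_mul_same U
  have hAX : (A * X).trace = ∑ i, hA.eigenvalues i * Y i i := by
    have h : (A * X).trace = (diagonal hA.eigenvalues * Y).trace := by
      conv_lhs => rw [hspec]
      rw [hY, Matrix.mul_assoc, Matrix.mul_assoc, Matrix.trace_mul_comm]
      simp only [Matrix.mul_assoc]
    rw [h]
    simp [Matrix.trace]
  have hXX : (X * X).trace = ∑ i, ∑ k, Y i k ^ 2 := by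
    have h : (X * X).trace = (Y * Y).trace := by
      have : Y * Y = Uᴴ * (X * X * U) := by
        calc Y * Y = Uᴴ * (X * (U * Uᴴ) * X * U) := by simp only [hY, Matrix.mul_assoc]
          _ = _ := by rw [hUU, Matrix.mul_one]
      rw [this, Matrix.trace_mul_comm Uᴴ, Matrix.mul_assoc, hUU, Matrix.mul_one]
    rw [h]
    simp only [Matrix.trace, Matrix.diag_apply, Matrix.mul_apply]
    refine Finset.sum_congr rfl fun i _ ↦ Finset.sum_congr rfl fun k _ ↦ ?_
    have := hYpsd.isHermitian.apply i k
    rw [star_trivial] at this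
    rw [this, sq]
  rw [hAX, hXX, Finset.mul_sum, ← Finset.sum_sub_distrib]
  refine Finset.sum_le_sum fun i _ ↦ ?_
  have h1 : Y i i ^ 2 ≤ ∑ k, Y i k ^ 2 :=
    Finset.single_le_sum (f := fun k ↦ Y i k ^ 2) (fun _ _ ↦ sq_nonneg _) (Finset.mem_univ i)
  have h2 : 0 ≤ Y i i := hYpsd.diag_nonneg
  split_ifs with h
  · nlinarith [sq_nonneg (hA.eigenvalues i - Y i i)]
  · nlinarith

theorem exists_posSemidef_sub_eq {n : Type*} [Fintype n] [DecidableEq n]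
    {B : Matrix n n ℝ} (hB : B.IsHermitian) :
    ∃ Y Z : Matrix n n ℝ, Y.PosSemidef ∧ Z.PosSemidef ∧ B = Y - Z ∧ Y * Z = 0 ∧ Z * Y = 0 := by
  set U : Matrix n n ℝ := (hB.eigenvectorUnitary : Matrix n n ℝ)
  have hUU : Uᴴ * U = 1 := Unitary.coe_star_mul_self hB.eigenvectorUnitary
  have hmul (d e : n → ℝ) (h : ∀ i, d i * e i = 0) :
      U * diagonal d * Uᴴ * (U * diagonal e * Uᴴ) = 0 := by
    calc _ = U * diagonal d * (Uᴴ * U) * diagonal e * Uᴴ := by simp only [Matrix.mul_assoc]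
      _ = U * (diagonal d * diagonal e) * Uᴴ := by rw [hUU, Matrix.mul_one, Matrix.mul_assoc U]
      _ = 0 := by simp [Matrix.diagonal_mul_diagonal, h]
  refine ⟨U * diagonal (fun i ↦ max (hB.eigenvalues i) 0) * Uᴴ,
    U * diagonal (fun i ↦ max (-hB.eigenvalues i) 0) * Uᴴ,
    (PosSemidef.diagonal fun i ↦ le_max_right _ _).mul_mul_conjTranspose_same U,
    (PosSemidef.diagonal fun i ↦ le_max_right _ _).mul_mul_conjTranspose_same U, ?_,
    hmul _ _ fun i ↦ ?_, hmul _ _ fun i ↦ ?_⟩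
  · rw [← Matrix.sub_mul, ← Matrix.mul_sub, Matrix.diagonal_sub]
    simp only [max_zero_sub_max_neg_zero_eq_self]
    conv_lhs => rw [hB.spectral_theorem, Unitary.conjStarAlgAut_apply]
    rfl
  all_goals rcases le_total 0 (hB.eigenvalues i) with h | h <;> simp [h]

/-- A symmetric matrix that is conjugate to its negative by a symmetric involution, such as the
adjacency matrix of a bipartite graph, has at least half of its square energy on the positive
side. -/
theorem exists_posSemidef_trace_sq_le {n : Type*} [Fintype n] [DecidableEq n]
    {B D : Matrix n n ℝ} (hB : B.IsHermitian) (hD : D.IsHermitian) (hDD : D * D = 1)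
    (hDB : D * B * D = -B) :
    ∃ X : Matrix n n ℝ, X.PosSemidef ∧
      (B * B).trace / 2 ≤ 2 * (B * X).trace - (X * X).trace := by
  obtain ⟨Y, Z, hY, hZ, hBYZ, hYZ, hZY⟩ := exists_posSemidef_sub_eq hB
  have hBB : (B * B).trace = (Y * Y).trace + (Z * Z).trace := by
    rw [hBYZ, ← trace_add]
    congr 1
    simp [Matrix.sub_mul, Matrix.mul_sub, hYZ, hZY]
  rcases le_total (Z * Z).trace (Y * Y).trace with h | h
  · refine ⟨Y, hY, ?_⟩
    have : B * Y = Y * Y := by rw [hBYZ, Matrix.sub_mul, hZY, sub_zero]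
    rw [this]
    linarith
  · refine ⟨D * Z * D, ?_, ?_⟩
    · simpa only [hD.eq] using hZ.mul_mul_conjTranspose_same D
    have h1 : (B * (D * Z * D)).trace = (Z * Z).trace := by
      calc (B * (D * Z * D)).trace = (B * D * Z * D).trace := by simp only [Matrix.mul_assoc]
        _ = (D * B * D * Z).trace := by rw [Matrix.trace_mul_comm]; simp only [Matrix.mul_assoc]
        _ = _ := by rw [hDB, hBYZ, neg_sub, Matrix.sub_mul, hYZ, sub_zero]
    have h2 : (D * Z * D * (D * Z * D)).trace = (Z * Z).trace := by
      calc _ = (D * (Z * (D * D) * Z * D)).trace := by simp only [Matrix.mul_assoc]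
        _ = _ := by
          rw [Matrix.trace_mul_comm, hDD, Matrix.mul_one, Matrix.mul_assoc, hDD, Matrix.mul_one]
    rw [h1, h2]
    linarith

theorem posSemidef_fromBlocks_diagonal {m n : Type*} [Fintype m] [Fintype n] [DecidableEq m]
    [DecidableEq n] {X : Matrix m m ℝ} {Y : Matrix n n ℝ} (hX : X.PosSemidef)
    (hY : Y.PosSemidef) : (fromBlocks X 0 0 Y).PosSemidef := by
  have h1 := hX.conjTranspose_mul_mul_same (fromCols (1 : Matrix m m ℝ) (0 : Matrix m n ℝ))
  have h2 := hY.conjTranspose_mul_mul_same (fromCols (0 : Matrix n m ℝ) (1 : Matrix n n ℝ))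
  convert h1.add h2 using 1
  simp only [conjTranspose_fromCols_eq_fromRows_conjTranspose, conjTranspose_one,
    conjTranspose_zero, fromRows_mul, mul_fromCols, Matrix.one_mul, Matrix.zero_mul,
    Matrix.mul_one, Matrix.mul_zero]
  ext (i | i) (k | k) <;> simp

/-- The positive square energy of a symmetric matrix dominates that of a diagonal block plus the
variational lower bound for the complementary one. -/
theorem block_bound_le_sum_eigenvalues {m n : Type*} [Fintype m] [Fintype n] [DecidableEq m]
    [DecidableEq n] {A : Matrix (m ⊕ n) (m ⊕ n) ℝ} (hA : A.IsHermitian) {X : Matrix m m ℝ}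
    {Y : Matrix n n ℝ} (hX : X.PosSemidef) (hY : Y.PosSemidef) :
    (2 * (A.toBlocks₁₁ * X).trace - (X * X).trace) +
      (2 * (A.toBlocks₂₂ * Y).trace - (Y * Y).trace) ≤
      ∑ i, if 0 < hA.eigenvalues i then hA.eigenvalues i ^ 2 else 0 := by
  refine le_trans (le_of_eq ?_) (two_mul_trace_sub_le_sum_eigenvalues hA
    (posSemidef_fromBlocks_diagonal hX hY))
  have h : A * fromBlocks X 0 0 Y = fromBlocks (A.toBlocks₁₁ * X) (A.toBlocks₁₂ * Y)
      (A.toBlocks₂₁ * X) (A.toBlocks₂₂ * Y) := by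
    conv_lhs => rw [← fromBlocks_toBlocks A]
    simp [fromBlocks_multiply]
  rw [h, fromBlocks_multiply]
  simp only [trace, diag_apply, Fintype.sum_sum_type, fromBlocks_apply₁₁, fromBlocks_apply₂₂,
    Matrix.mul_zero, Matrix.zero_mul, add_zero, zero_add]
  ring

theorem sum_path_adjacency (j : ℕ) : 2 * ((j : ℝ) - 1) ≤
    ∑ p : Fin j, ∑ q : Fin j, if q.val = p.val + 1 ∨ p.val = q.val + 1 then (1 : ℝ) else 0 := by
  rcases j with _ | n
  · norm_num
  have hsplit (p q : Fin (n + 1)) :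
      (if q.val = p.val + 1 ∨ p.val = q.val + 1 then (1 : ℝ) else 0) =
        (if q.val = p.val + 1 then 1 else 0) + if p.val = q.val + 1 then 1 else 0 := by
    split_ifs <;> first | omega | norm_num
  have hone : (n : ℝ) ≤
      ∑ p : Fin (n + 1), ∑ q : Fin (n + 1), if q.val = p.val + 1 then (1 : ℝ) else 0 := by
    rw [Fin.sum_univ_castSucc]
    refine le_add_of_le_of_nonneg ?_ (Finset.sum_nonneg fun _ _ ↦ by positivity)
    calc (n : ℝ) = ∑ _p : Fin n, (1 : ℝ) := by simp
      _ ≤ _ := Finset.sum_le_sum fun p _ ↦ by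
        refine le_trans (by simp) (Finset.single_le_sum (f := fun q : Fin (n + 1) ↦
          if q.val = p.castSucc.val + 1 then (1 : ℝ) else 0)
          (fun _ _ ↦ by positivity) (Finset.mem_univ p.succ))
  simp only [hsplit, Finset.sum_add_distrib]
  rw [Finset.sum_comm (f := fun p q : Fin (n + 1) ↦ if p.val = q.val + 1 then (1 : ℝ) else 0)]
  push_cast
  linarith

theorem exists_posSemidef_path_bound (j : ℕ) [DecidableRel (trianglePaths j 0 0).Adj] :
    ∃ X, X.PosSemidef ∧ (j : ℝ) - 1 ≤
      2 * (((trianglePaths j 0 0).adjMatrix ℝ).toBlocks₂₂ * X).trace - (X * X).trace := by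
  set B := ((trianglePaths j 0 0).adjMatrix ℝ).toBlocks₂₂
  have hentry (p q : Fin j) : B (Sum.inl p) (Sum.inl q) =
      if q.val = p.val + 1 ∨ p.val = q.val + 1 then 1 else 0 := by
    simp only [B, toBlocks₂₂, of_apply, SimpleGraph.adjMatrix_apply]
    refine if_congr ?_ rfl rfl
    rw [trianglePaths, SimpleGraph.fromRel_adj]
    refine ⟨fun h ↦ h.2, fun h ↦ ⟨?_, h⟩⟩
    rintro ⟨⟩
    omega
  have hB : B.IsHermitian := (adj_isHermitian (trianglePaths j 0 0)).submatrix Sum.inr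
  let d : Fin j ⊕ Fin 0 ⊕ Fin 0 → ℝ := Sum.elim (fun p ↦ (-1) ^ p.val) fun _ ↦ 1
  obtain ⟨X, hX, hle⟩ := exists_posSemidef_trace_sq_le (D := diagonal d) hB
    (isHermitian_diagonal _) (by
      rw [diagonal_mul_diagonal, ← diagonal_one]
      congr 1
      ext (p | p)
      · simp [d, ← mul_pow]
      · simp [d]) (by
      ext (p | p) (q | q)
      · rw [mul_diagonal, diagonal_mul, Matrix.neg_apply, hentry]
        split_ifs with h
        · rcases h with h | h <;> simp [d, h, pow_succ, ← mul_pow]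
        · simp
      all_goals first | exact p.elim Fin.elim0 Fin.elim0 | exact q.elim Fin.elim0 Fin.elim0)
  refine ⟨X, hX, le_trans ?_ hle⟩
  have hBB : (B * B).trace =
      ∑ p : Fin j, ∑ q : Fin j, if q.val = p.val + 1 ∨ p.val = q.val + 1 then (1 : ℝ) else 0 := by
    simp only [trace, diag_apply, mul_apply, Fintype.sum_sum_type, Finset.univ_eq_empty,
      Finset.sum_empty, add_zero, hentry]
    refine Finset.sum_congr rfl fun p _ ↦ Finset.sum_congr rfl fun q _ ↦ ?_
    split_ifs <;> first | omega | norm_num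
  rw [hBB]
  linarith [sum_path_adjacency j]

theorem exists_posSemidef_triangle_bound (j k l : ℕ) [DecidableRel (trianglePaths j k l).Adj] :
    ∃ X, X.PosSemidef ∧
      2 * (((trianglePaths j k l).adjMatrix ℝ).toBlocks₁₁ * X).trace - (X * X).trace = 4 := by
  refine ⟨(2 / 3 : ℝ) • vecMulVec (fun _ ↦ 1) (star fun _ ↦ 1),
    (posSemidef_vecMulVec_self_star _).smul (by norm_num), ?_⟩
  have h : ((trianglePaths j k l).adjMatrix ℝ).toBlocks₁₁ = of fun x y ↦ if x = y then 0 else 1 := by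
    ext x y
    have hadj : (trianglePaths j k l).Adj (Sum.inl x) (Sum.inl y) ↔ ¬ x = y := by
      simp [trianglePaths, trianglePathsRel]
    simp [toBlocks₁₁, SimpleGraph.adjMatrix_apply, hadj, ite_not]
  rw [h]
  simp [trace, mul_apply, Fin.sum_univ_three, vecMulVec_apply]
  norm_num

/-- `s⁺(P(j,0,0)) ≥ j + 3`. -/
theorem stmt_9 (j : ℕ) :
    (j : ℝ) + 3 ≤ sPlus (trianglePaths j 0 0) := by
  let := Classical.decRel (trianglePaths j 0 0).Adj
  obtain ⟨X, hX, hX'⟩ := exists_posSemidef_triangle_bound j 0 0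
  obtain ⟨Y, hY, hY'⟩ := exists_posSemidef_path_bound j
  have h := block_bound_le_sum_eigenvalues (adj_isHermitian (trianglePaths j 0 0)) hX hY
  refine le_trans ?_ h
  linarith

end SquareEnergy
end
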